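/- There exists η > 0 with the following property: let Λ_k = a_kα + b_kβ and Λ_l = a_lα + b_lβ be binary linear forms with integer coefficients, (a_k,b_k) ≠ (0,0), (a_l,b_l) ≠ (0,0), and a_k b_l − a_l b_k ≠ 0. Then there is a constant C depending at most on the coefficients such that for all sufficiently large P and all R with 2 ≤ R ≤ P^η one has sup_{(α,β)∈𝔫} |h(Λ_k;P,R) h(Λ_l;P,R)| ≤ C·P²·Q^{−1/100}. -/

import Mathlib

open scoped Real
open Filter MeasureTheory

noncomputable section

/-- `e(z) = exp(2πiz)`. -/
def e (z : ℝ) : ℂ := Complex.exp (2 * Real.pi * Complex.I * z)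

/-- The set `𝒜(P,R)` of `R`-smooth positive integers not exceeding `P`. -/
def smoothA (P R : ℝ) : Finset ℕ :=
  (Finset.Icc 1 ⌊P⌋₊).filter (fun n => ∀ p ∈ n.primeFactors, (p : ℝ) ≤ R)

/-- The smooth Weyl sum `h(α; P, R)`. -/
def h (P R α : ℝ) : ℂ := ∑ x ∈ smoothA P R, e (α * (x : ℝ) ^ 4)

/-- `Δ₇ = 0.849408`. -/
def Δ₇ : ℝ := 0.849408

/-- `Δ₁₀ = 0.213431`. -/
def Δ₁₀ : ℝ := 0.213431

/-- `Q = (log P)^{1/100}`. -/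
def Qbig (P : ℝ) : ℝ := (Real.log P) ^ ((1:ℝ)/100)

/-- The two-dimensional major arcs `𝔑`: the union of the boxes `𝔑(q,a,b)` over
`0 ≤ a, b ≤ q ≤ Q` with `gcd(q,a,b) = 1`. -/
def majN (P : ℝ) : Set (ℝ × ℝ) :=
  {x | x.1 ∈ Set.Ico (0:ℝ) 1 ∧ x.2 ∈ Set.Ico (0:ℝ) 1 ∧
    ∃ q a b : ℕ, 1 ≤ q ∧ (q : ℝ) ≤ Qbig P ∧ a ≤ q ∧ b ≤ q ∧
      Nat.gcd q (Nat.gcd a b) = 1 ∧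
      |x.1 - (a : ℝ) / (q : ℝ)| ≤ Qbig P * P ^ (-(4:ℤ)) ∧
      |x.2 - (b : ℝ) / (q : ℝ)| ≤ Qbig P * P ^ (-(4:ℤ))}

/-- The minor arcs `𝔫 = [0,1)² \ 𝔑`. -/
def minorn (P : ℝ) : Set (ℝ × ℝ) := (Set.Ico (0:ℝ) 1 ×ˢ Set.Ico (0:ℝ) 1) \ majN P

/-- If many integers `n ∈ (-M, M)` have `n * θ` within `ε` of an integer, then `θ` is
very close to a rational number with small denominator. -/
theorem exists_small_denominator_of_many_near_int {M : ℕ} {θ δ ε : ℝ} (hM : 0 < M) (hδ : 0 < δ)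
    (hε : 0 < ε) (hεδ : 128 * ε ≤ δ) (hδM : 32 ≤ δ * M) (S : Finset ℤ)
    (hS : S ⊆ Finset.Ioo (-(M : ℤ)) M) (hcard : δ * M ≤ S.card)
    (hnear : ∀ n ∈ S, ∃ z : ℤ, |n * θ - z| ≤ ε) :
    ∃ t : ℕ, 1 ≤ t ∧ (t : ℝ) ≤ 13 / δ ∧ ∃ z : ℤ, |t * θ - z| ≤ 64 * ε / (δ * M) := by
  have hM' : (1 : ℝ) ≤ M := by exact_mod_cast hM
  set X : ℕ := ⌊δ * M / (64 * ε)⌋₊ with hX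
  have hX1 : 1 ≤ X := by
    apply Nat.le_floor
    rw [Nat.cast_one, le_div_iff₀ (by positivity)]
    nlinarith
  have hXle : (X : ℝ) ≤ δ * M / (64 * ε) := Nat.floor_le (by positivity)
  have hXlt : δ * M / (64 * ε) < X + 1 := Nat.lt_floor_add_one _
  obtain ⟨q, hq, hqX⟩ := Real.exists_rat_abs_sub_le_and_den_le θ hX1
  set t : ℕ := q.den with ht
  have ht1 : 1 ≤ t := q.den_pos
  have ht0 : (0 : ℝ) < t := by exact_mod_cast ht1
  have htX : (t : ℝ) ≤ X := by exact_mod_cast hqX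
  have hqt : (q : ℝ) = q.num / t := by rw [ht]; exact_mod_cast (Rat.num_div_den q).symm
  have hsep : ∀ k : ℤ, k ≠ 0 → 2 * |k| < t → ∀ z : ℤ, 1 / (2 * (t : ℝ)) < |k * θ - z| := by
    intro k hk hkt z
    have h1 : (1 : ℝ) / t ≤ |k * (q : ℝ) - z| := by
      rw [hqt, show (k : ℝ) * (q.num / t) - z = ((k * q.num - z * t : ℤ) : ℝ) / t by
        push_cast; field_simp, abs_div, abs_of_pos ht0]
      apply div_le_div_of_nonneg_right _ ht0.le
      have : k * q.num - z * t ≠ 0 := by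
        intro h0
        have h2 : (t : ℤ) ∣ k * q.num := ⟨z, by linarith⟩
        have h3 : IsCoprime (t : ℤ) q.num := by
          rw [Int.isCoprime_iff_gcd_eq_one, Int.gcd_comm]
          have := q.reduced
          simpa [Int.gcd, Nat.Coprime, ht] using this
        have h4 := h3.dvd_of_dvd_mul_right h2
        have h5 := Int.le_of_dvd (abs_pos.2 hk) ((dvd_abs _ _).2 h4)
        have := abs_pos.2 hk
        omega
      exact_mod_cast Int.one_le_abs this
    have h2 : |(k : ℝ) * (θ - q)| < 1 / (2 * (t : ℝ)) := by
      rw [abs_mul]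
      have hk1 : 2 * |(k : ℝ)| < t := by exact_mod_cast hkt
      have hk2 : |(k : ℝ)| < t / 2 := by linarith
      calc |(k : ℝ)| * |θ - q| ≤ |(k : ℝ)| * (1 / ((X + 1) * t)) := by gcongr
        _ ≤ t / 2 * (1 / ((X + 1) * t)) := by gcongr
        _ < 1 / (2 * (t : ℝ)) := by
          rw [show (t : ℝ) / 2 * (1 / ((X + 1) * t)) = 1 / (2 * (X + 1)) by field_simp]
          apply one_div_lt_one_div_of_lt (by positivity)
          linarith
    have h3 : (1 : ℝ) / t = 1 / (2 * t) + 1 / (2 * t) := by field_simp; norm_num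
    have h4 : |k * (q : ℝ) - z| ≤ |k * θ - z| + |(k : ℝ) * (θ - q)| := by
      rw [show k * (q : ℝ) - z = (k * θ - z) - k * (θ - q) by ring]
      exact abs_sub _ _
    linarith
  choose! z hz using hnear
  set L : ℤ := (t + 1) / 2 with hL
  have hL1 : 1 ≤ L := by omega
  have hLt : (t : ℝ) / 2 ≤ L := by
    have : (t : ℤ) ≤ 2 * L := by omega
    have : (t : ℝ) ≤ 2 * L := by exact_mod_cast this
    linarith
  have hbox : S.card ≤ (Finset.Icc (-((M : ℤ) / L) - 1) ((M : ℤ) / L) ×ˢ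
      Finset.Icc ⌊-(2 * t * ε)⌋ ⌊2 * t * ε⌋).card := by
    refine Finset.card_le_card_of_injOn (fun n => (n / L, ⌊2 * t * (n * θ - z n)⌋)) ?_ ?_
    · intro n hn
      have hnM := Finset.mem_Ioo.1 (hS hn)
      have hb := abs_le.1 (hz n hn)
      simp only [Finset.coe_product, Set.mem_prod, Finset.mem_coe, Finset.mem_Icc]
      refine ⟨⟨?_, Int.ediv_le_ediv (by omega) hnM.2.le⟩, Int.floor_le_floor ?_,
        Int.floor_le_floor ?_⟩
      · rw [Int.le_ediv_iff_mul_le (by omega)]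
        have h1 := Int.mul_ediv_add_emod (M : ℤ) L
        have h2 := Int.emod_lt_of_pos (M : ℤ) (show 0 < L by omega)
        nlinarith
      · nlinarith [hb.1, hb.2]
      · nlinarith [hb.1, hb.2]
    · intro n hn m hm hnm
      simp only [Prod.mk.injEq] at hnm
      by_contra hne
      have h1 := Int.mul_ediv_add_emod n L
      have h2 := Int.mul_ediv_add_emod m L
      have h3 := Int.emod_lt_of_pos n (show 0 < L by omega)
      have h4 := Int.emod_lt_of_pos m (show 0 < L by omega)
      have h5 := Int.emod_nonneg n (show L ≠ 0 by omega)
      have h6 := Int.emod_nonneg m (show L ≠ 0 by omega)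
      rw [hnm.1] at h1
      have h7 := hsep (n - m) (sub_ne_zero.2 hne) (by
        have : |n - m| ≤ L - 1 := by rw [abs_le]; constructor <;> linarith
        omega) (z n - z m)
      have h8 := Int.abs_sub_lt_one_of_floor_eq_floor hnm.2
      rw [← mul_sub, abs_mul, abs_of_pos (by positivity)] at h8
      rw [div_lt_iff₀ (by positivity)] at h7
      push_cast at h7
      rw [show ((n : ℝ) - m) * θ - (z n - z m) = n * θ - z n - (m * θ - z m) by ring] at h7
      linarith
  have hcount : (S.card : ℝ) ≤ (4 * M / t + 2) * (4 * t * ε + 2) := by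
    refine (Nat.cast_le.2 hbox).trans ?_
    rw [Finset.card_product, Nat.cast_mul]
    gcongr
    · have h1 : (M : ℤ) / L ≥ 0 := Int.ediv_nonneg (by omega) (by omega)
      have h2 : (((M : ℤ) / L : ℤ) : ℝ) ≤ (M : ℝ) / L := by
        rw [le_div_iff₀ (by exact_mod_cast hL1)]
        exact_mod_cast Int.ediv_mul_le (M : ℤ) (show L ≠ 0 by omega)
      have h3 : (M : ℝ) / L ≤ M / (t / 2) := by gcongr
      have h4 : (M : ℝ) / (t / 2) = 2 * M / t := by field_simp
      rw [Int.card_Icc]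
      have h5 : (((M : ℤ) / L + 1 - (-((M : ℤ) / L) - 1)).toNat : ℝ) =
          2 * (((M : ℤ) / L : ℤ) : ℝ) + 2 := by
        rw [← Int.cast_natCast, Int.toNat_of_nonneg (by omega)]
        push_cast; ring
      rw [h5]
      have h6 : (4 : ℝ) * M / t = 2 * (2 * M / t) := by ring
      linarith
    · rw [Int.card_Icc]
      have hfl := Int.floor_le_floor (show -(2 * t * ε) ≤ 2 * t * ε by
        have : 0 < 2 * t * ε := by positivity
        linarith)
      rw [← Int.cast_natCast, Int.toNat_of_nonneg (by omega)]
      push_cast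
      have := Int.floor_le (2 * t * ε)
      have := Int.lt_floor_add_one (-(2 * t * ε))
      linarith
  refine ⟨t, ht1, ?_, q.num, ?_⟩
  · have h1 : δ * M ≤ 16 * M * ε + 8 * M / t + 8 * t * ε + 4 := by
      refine hcard.trans (hcount.trans (le_of_eq ?_))
      field_simp
      ring
    have h2 : 8 * t * ε ≤ δ * M / 8 := by
      have : (t : ℝ) ≤ δ * M / (64 * ε) := htX.trans hXle
      rw [le_div_iff₀ (by positivity)] at this
      linarith
    have h3 : 16 * M * ε ≤ δ * M / 8 := by nlinarith
    have h4 : 5 * (δ * M) / 8 ≤ 8 * M / t := by linarith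
    rw [le_div_iff₀ ht0] at h4
    rw [le_div_iff₀ hδ]
    have h5 : M * (5 * (δ * t)) ≤ M * 64 := by nlinarith
    have := le_of_mul_le_mul_left h5 (by linarith)
    linarith
  · have h1 : |(t : ℝ) * θ - q.num| = t * |θ - q| := by
      rw [hqt, ← abs_of_pos ht0, ← abs_mul, abs_of_pos ht0]
      congr 1
      field_simp
    rw [h1]
    calc (t : ℝ) * |θ - q| ≤ t * (1 / ((X + 1) * t)) := by gcongr
      _ = 1 / (X + 1) := by field_simp
      _ ≤ 1 / (δ * M / (64 * ε)) := by gcongr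
      _ = _ := by field_simp

/-- A fibred version of `exists_small_denominator_of_many_near_int`. -/
theorem exists_small_denominator_fibred {ι : Type*} [DecidableEq ι] {M : ℕ} {δ ε : ℝ}
    (hM : 0 < M) (hδ : 0 < δ) (hδ1 : δ ≤ 1) (hε : 0 < ε) (hεδ : 256 * ε ≤ δ)
    (hδM : 64 ≤ δ * M) (A : Finset ι) (g : ι → ℝ) (S : Finset (ι × ℤ))
    (hS : S ⊆ A ×ˢ Finset.Ioo (-(M : ℤ)) M) (hcard : δ * A.card * M ≤ S.card)
    (hnear : ∀ s ∈ S, ∃ z : ℤ, |s.2 * g s.1 - z| ≤ ε) :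
    ∃ t : ℕ, 1 ≤ t ∧ (t : ℝ) ≤ 26 / δ ∧ ∃ A' ⊆ A, δ ^ 2 / 104 * A.card ≤ A'.card ∧
      ∀ a ∈ A', ∃ z : ℤ, |t * g a - z| ≤ 128 * ε / (δ * M) := by
  set F : ι → Finset ℤ := fun a => (Finset.Ioo (-(M : ℤ)) M).filter (fun n => (a, n) ∈ S) with hF
  set A₁ := A.filter (fun a => δ / 2 * M ≤ (F a).card) with hA₁
  have hFle : ∀ a, ((F a).card : ℝ) ≤ 2 * M := by
    intro a
    have h1 : (F a).card ≤ (Finset.Ioo (-(M : ℤ)) M).card := Finset.card_filter_le _ _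
    rw [Int.card_Ioo] at h1
    have : (F a).card ≤ 2 * M := by omega
    exact_mod_cast this
  have hSsum : (S.card : ℝ) ≤ ∑ a ∈ A, ((F a).card : ℝ) := by
    rw [← Nat.cast_sum, ← Finset.card_sigma]
    refine Nat.cast_le.2 (Finset.card_le_card_of_injOn (fun s => ⟨s.1, s.2⟩) ?_ ?_)
    · intro s hs
      have := Finset.mem_product.1 (hS hs)
      simp only [Finset.coe_sigma, Set.mem_sigma_iff, Finset.mem_coe, hF, Finset.mem_filter]
      exact ⟨this.1, this.2, hs⟩
    · rintro ⟨a, n⟩ - ⟨b, m⟩ - hab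
      simpa using hab
  have hA₁card : δ / 4 * A.card ≤ A₁.card := by
    have h1 : ∑ a ∈ A, ((F a).card : ℝ) ≤ A₁.card * (2 * M) + A.card * (δ / 2 * M) := by
      rw [← Finset.sum_filter_add_sum_filter_not A (fun a => δ / 2 * M ≤ (F a).card)]
      apply add_le_add
      · rw [← nsmul_eq_mul]
        exact Finset.sum_le_card_nsmul _ _ _ (fun a _ => hFle a)
      · rw [← nsmul_eq_mul]
        refine (Finset.sum_le_card_nsmul _ _ (δ / 2 * M) (fun a ha => ?_)).trans ?_
        · exact (not_le.1 (Finset.mem_filter.1 ha).2).le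
        · apply nsmul_le_nsmul_left (by positivity) (Finset.card_filter_le _ _)
    have hM' : (0 : ℝ) < M := by exact_mod_cast hM
    have h2 : (δ / 4 * A.card) * M ≤ A₁.card * M := by linarith
    exact le_of_mul_le_mul_right h2 hM'
  have hV : ∀ a ∈ A₁, ∃ t : ℕ, 1 ≤ t ∧ (t : ℝ) ≤ 26 / δ ∧
      ∃ z : ℤ, |t * g a - z| ≤ 128 * ε / (δ * M) := by
    intro a ha
    obtain ⟨t, h1, h2, z, hz⟩ := exists_small_denominator_of_many_near_int (θ := g a)
      (δ := δ / 2) (ε := ε) hM (by positivity) hε (by linarith) (by linarith) (F a)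
      (Finset.filter_subset _ _) (Finset.mem_filter.1 ha).2
      (fun n hn => hnear (a, n) (Finset.mem_filter.1 hn).2)
    refine ⟨t, h1, h2.trans (le_of_eq (by field_simp; norm_num)), z,
      hz.trans (le_of_eq (by field_simp; norm_num))⟩
  choose! τ hτ1 hτ2 hτ3 using hV
  have h26 : (1 : ℝ) ≤ 26 / δ := by rw [le_div_iff₀ hδ]; linarith
  have hne : (Finset.Icc 1 ⌊26 / δ⌋₊).Nonempty :=
    ⟨1, Finset.mem_Icc.2 ⟨le_rfl, Nat.le_floor (by simpa using h26)⟩⟩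
  obtain ⟨t, ht, hfib⟩ := Finset.exists_le_card_fiber_of_nsmul_le_card_of_maps_to
    (s := A₁) (t := Finset.Icc 1 ⌊26 / δ⌋₊) (f := τ) (b := δ / 26 * A₁.card)
    (fun a ha => Finset.mem_Icc.2 ⟨hτ1 a ha, Nat.le_floor (hτ2 a ha)⟩) hne (by
      rw [Nat.card_Icc, nsmul_eq_mul, Nat.add_sub_cancel]
      calc (⌊26 / δ⌋₊ : ℝ) * (δ / 26 * A₁.card) ≤ 26 / δ * (δ / 26 * A₁.card) := by
            gcongr
            exact Nat.floor_le (by positivity)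
        _ = A₁.card := by field_simp)
  rw [Finset.mem_Icc] at ht
  refine ⟨t, ht.1, (Nat.le_floor_iff (by positivity)).1 ht.2, A₁.filter (fun a => τ a = t),
    (Finset.filter_subset _ _).trans (Finset.filter_subset _ _), ?_, ?_⟩
  · refine le_trans ?_ hfib
    calc δ ^ 2 / 104 * A.card = δ / 26 * (δ / 4 * A.card) := by ring
      _ ≤ _ := by gcongr
  · intro a ha
    rw [Finset.mem_filter] at ha
    rw [← ha.2]
    exact hτ3 a ha.1

/-- If `x * y * w * θ` is close to an integer for many triples `(x, y, w)`, then `θ` is very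
close to a rational number with small denominator. -/
theorem exists_small_denominator_of_many_triples {M : ℕ} {θ δ ε : ℝ}
    (hM : 0 < M) (hδ : 0 < δ) (hδ1 : δ ≤ 1) (hε : 0 < ε) (hεδ : 10 ^ 12 * ε ≤ δ ^ 4)
    (hδM : 10 ^ 12 ≤ δ ^ 4 * M) (S : Finset ((ℤ × ℤ) × ℤ))
    (hS : S ⊆ (Finset.Ioo (-(M : ℤ)) M ×ˢ Finset.Ioo (-(M : ℤ)) M) ×ˢ Finset.Ioo (-(M : ℤ)) M)
    (hcard : δ * M ^ 3 ≤ S.card)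
    (hnear : ∀ s ∈ S, ∃ z : ℤ, |s.1.1 * s.1.2 * s.2 * θ - z| ≤ ε) :
    ∃ t : ℕ, 1 ≤ t ∧ (t : ℝ) ≤ 10 ^ 20 / δ ^ 7 ∧
      ∃ z : ℤ, |t * θ - z| ≤ 10 ^ 20 * ε / (δ ^ 7 * M ^ 3) := by
  have hM1 : (1 : ℝ) ≤ M := by exact_mod_cast hM
  have hδ4 : δ ^ 4 ≤ δ := pow_le_of_le_one hδ.le hδ1 (by norm_num)
  have hδ42 : δ ^ 4 ≤ δ ^ 2 := pow_le_pow_of_le_one hδ.le hδ1 (by norm_num)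
  set I := Finset.Ioo (-(M : ℤ)) M with hI
  have hIc : (I.card : ℝ) = 2 * M - 1 := by
    have : I.card = 2 * M - 1 := by rw [hI, Int.card_Ioo]; omega
    rw [this, Nat.cast_sub (by omega)]
    push_cast; ring
  have hI1 : (M : ℝ) ≤ I.card := by rw [hIc]; linarith
  have hI2 : (I.card : ℝ) ≤ 2 * M := by rw [hIc]; linarith
  have hM0 : (0 : ℝ) < M := by linarith
  have hεM : ε / (δ * M) ≤ ε / δ := by
    gcongr
    nlinarith
  have hεδ' : 10 ^ 12 * (ε / δ) ≤ δ ^ 3 := by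
    rw [mul_div_assoc', div_le_iff₀ hδ]
    linarith
  have hδ3 : δ ^ 3 ≤ δ ^ 2 := pow_le_pow_of_le_one hδ.le hδ1 (by norm_num)
  obtain ⟨t₁, h11, h12, A₂, hA₂, hA₂c, hA₂n⟩ := exists_small_denominator_fibred (δ := δ / 4)
    (ε := ε) hM (by positivity) (by linarith) hε (by linarith) (by nlinarith) (I ×ˢ I)
    (fun a => a.1 * a.2 * θ) S hS (by
      rw [Finset.card_product, Nat.cast_mul]
      refine le_trans ?_ hcard
      calc δ / 4 * (I.card * I.card) * M ≤ δ / 4 * (2 * M * (2 * M)) * M := by gcongr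
        _ = _ := by ring) (fun s hs => by
      obtain ⟨z, hz⟩ := hnear s hs
      exact ⟨z, by rwa [show (s.2 : ℝ) * (s.1.1 * s.1.2 * θ) = s.1.1 * s.1.2 * s.2 * θ by ring]⟩)
  set ε₁ : ℝ := 128 * ε / (δ / 4 * M) with hε₁
  have hε₁' : ε₁ = 512 * (ε / (δ * M)) := by rw [hε₁]; field_simp; norm_num
  have hε₁le : 10 ^ 8 * ε₁ ≤ δ ^ 3 := by
    have : 0 < ε / δ := by positivity
    rw [hε₁']
    linarith
  have hδ2M : 10 ^ 12 ≤ δ ^ 2 * M := hδM.trans (by gcongr)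
  obtain ⟨t₂, h21, h22, A₃, hA₃, hA₃c, hA₃n⟩ := exists_small_denominator_fibred
    (δ := δ ^ 2 / 3328) (ε := ε₁) hM (by positivity)
    ((div_le_one (by norm_num)).2 (by nlinarith)) (by positivity) (by linarith) (by linarith) I
    (fun a => t₁ * a * θ) A₂ hA₂ (by
      rw [Finset.card_product, Nat.cast_mul] at hA₂c
      refine le_trans ?_ hA₂c
      calc δ ^ 2 / 3328 * I.card * M ≤ δ ^ 2 / 3328 * I.card * (2 * I.card) := by gcongr; linarith
        _ = _ := by ring) (fun s hs => by
      obtain ⟨z, hz⟩ := hA₂n s hs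
      exact ⟨z, by rwa [show (s.2 : ℝ) * (t₁ * s.1 * θ) = t₁ * (s.1 * s.2 * θ) by ring]⟩)
  set ε₂ : ℝ := 128 * ε₁ / (δ ^ 2 / 3328 * M) with hε₂
  have hε₂' : ε₂ = 425984 * (ε₁ / (δ ^ 2 * M)) := by rw [hε₂]; field_simp; ring
  have hε₂le : 10 ^ 14 * ε₂ ≤ δ ^ 4 := by
    rw [hε₂']
    have h1 : ε₁ / (δ ^ 2 * M) ≤ ε₁ * (δ ^ 2 / 10 ^ 12) := by
      rw [div_le_iff₀ (by positivity)]
      have : ε₁ * 1 ≤ ε₁ * (δ ^ 2 / 10 ^ 12 * (δ ^ 2 * M)) := by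
        have h3 : 0 < ε₁ := by positivity
        gcongr
        nlinarith
      linarith
    have h2 : ε₁ * (δ ^ 2 / 10 ^ 12) ≤ (δ ^ 3 / 10 ^ 8) * (δ ^ 2 / 10 ^ 12) := by
      gcongr
      linarith
    have h3 : δ ^ 3 * δ ^ 2 ≤ δ ^ 4 := by
      rw [← pow_add]
      exact pow_le_pow_of_le_one hδ.le hδ1 (by norm_num)
    nlinarith [pow_pos hδ 4]
  obtain ⟨t₃, h31, h32, z, hz⟩ := exists_small_denominator_of_many_near_int
    (θ := t₂ * t₁ * θ) (δ := δ ^ 4 / (3328 ^ 2 * 104)) (ε := ε₂) hM (by positivity)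
    (by positivity) (by linarith [pow_pos hδ 4]) (by linarith) A₃ hA₃ (by
      refine le_trans ?_ hA₃c
      calc δ ^ 4 / (3328 ^ 2 * 104) * M ≤ δ ^ 4 / (3328 ^ 2 * 104) * I.card := by gcongr
        _ = _ := by ring) (fun n hn => by
      obtain ⟨z, hz⟩ := hA₃n n hn
      exact ⟨z, by rwa [show (n : ℝ) * (t₂ * t₁ * θ) = t₂ * (t₁ * n * θ) by ring]⟩)
  refine ⟨t₃ * t₂ * t₁, ?_, ?_, z, ?_⟩
  · exact Nat.one_le_iff_ne_zero.2 (by positivity)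
  · push_cast
    calc (t₃ : ℝ) * t₂ * t₁ ≤ (13 / (δ ^ 4 / (3328 ^ 2 * 104))) * (26 / (δ ^ 2 / 3328)) *
          (26 / (δ / 4)) := by gcongr
      _ = (13 * (3328 ^ 2 * 104) * (26 * 3328) * (26 * 4)) / δ ^ 7 := by field_simp
      _ ≤ 10 ^ 20 / δ ^ 7 := by gcongr; norm_num
  · push_cast
    rw [show (t₃ : ℝ) * t₂ * t₁ * θ = t₃ * (t₂ * t₁ * θ) by ring]
    refine hz.trans ?_
    rw [hε₂, hε₁]
    calc _ = (64 * (3328 ^ 2 * 104) * 128 * 3328 * 128 * 4) * ε / (δ ^ 7 * M ^ 3) := by field_simp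
      _ ≤ _ := by gcongr; norm_num

/-- A submultiplicative function with linearly bounded values at prime powers is `O(n ^ ε)`. -/
theorem exists_le_mul_rpow_of_submultiplicative (g : ℕ → ℕ) (h_one : g 1 ≤ 1)
    (h_mul : ∀ m n, 0 < m → 0 < n → m.Coprime n → g (m * n) ≤ g m * g n)
    (h_prime_pow : ∀ p k, p.Prime → g (p ^ k) ≤ 8 * (k + 1)) {ε : ℝ} (hε : 0 < ε) :
    ∃ C : ℝ, 1 ≤ C ∧ ∀ n : ℕ, n ≠ 0 → (g n : ℝ) ≤ C * (n : ℝ) ^ ε := by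
  set s : ℝ := 2 ^ ε - 1 with hs
  have hs0 : 0 < s := by
    have := Real.one_lt_rpow (show (1 : ℝ) < 2 by norm_num) hε
    linarith
  set K : ℝ := 8 * (1 + 1 / s) with hK
  have hK1 : 1 ≤ K := by
    have : 0 < 1 / s := by positivity
    linarith
  obtain ⟨p₀, hp₀⟩ := exists_nat_ge ((16 : ℝ) ^ (1 / ε))
  have hsmall : ∀ p k : ℕ, p.Prime → (g (p ^ k) : ℝ) ≤ K * ((p ^ k : ℕ) : ℝ) ^ ε := by
    intro p k hp
    have h1 : (g (p ^ k) : ℝ) ≤ 8 * (k + 1) := by exact_mod_cast h_prime_pow p k hp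
    have h2 : 1 + k * s ≤ ((2 : ℝ) ^ ε) ^ k := by
      have := one_add_mul_le_pow (a := s) (by linarith) k
      rwa [show 1 + s = 2 ^ ε by rw [hs]; ring] at this
    have h3 : ((2 : ℝ) ^ ε) ^ k ≤ ((p : ℝ) ^ ε) ^ k := by
      gcongr
      exact_mod_cast hp.two_le
    have h4 : ((p ^ k : ℕ) : ℝ) ^ ε = ((p : ℝ) ^ ε) ^ k := by
      rw [Nat.cast_pow, ← Real.rpow_natCast, ← Real.rpow_natCast, ← Real.rpow_mul (by positivity),
        ← Real.rpow_mul (by positivity), mul_comm]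
    rw [h4]
    have h5 : K * (1 + k * s) ≤ K * ((p : ℝ) ^ ε) ^ k := by gcongr; linarith
    refine h1.trans (le_trans ?_ h5)
    have : K * (1 + k * s) = 8 * (k + 1) + 8 / s + 8 * k * s := by rw [hK]; field_simp; ring
    rw [this]
    have : 0 ≤ 8 / s + 8 * k * s := by positivity
    linarith
  have hlarge : ∀ p k : ℕ, p.Prime → p₀ ≤ p → 0 < k →
      (g (p ^ k) : ℝ) ≤ ((p ^ k : ℕ) : ℝ) ^ ε := by
    intro p k hp hpp hk
    have h1 : (g (p ^ k) : ℝ) ≤ 8 * (k + 1) := by exact_mod_cast h_prime_pow p k hp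
    have h2 : (16 : ℝ) ≤ (p : ℝ) ^ ε := by
      calc (16 : ℝ) = ((16 : ℝ) ^ (1 / ε)) ^ ε := by
            rw [← Real.rpow_mul (by norm_num), one_div_mul_cancel hε.ne', Real.rpow_one]
        _ ≤ (p : ℝ) ^ ε := by
            gcongr
            exact hp₀.trans (by exact_mod_cast hpp)
    have h4 : ((p ^ k : ℕ) : ℝ) ^ ε = ((p : ℝ) ^ ε) ^ k := by
      rw [Nat.cast_pow, ← Real.rpow_natCast, ← Real.rpow_natCast, ← Real.rpow_mul (by positivity),
        ← Real.rpow_mul (by positivity), mul_comm]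
    rw [h4]
    have h5 : (16 : ℝ) ^ k ≤ ((p : ℝ) ^ ε) ^ k := by gcongr
    have h6 : 1 + (k : ℝ) * 15 ≤ 16 ^ k := by
      have := one_add_mul_le_pow (a := (15 : ℝ)) (by norm_num) k
      norm_num at this ⊢
      exact this
    have h7 : (1 : ℝ) ≤ k := by exact_mod_cast hk
    linarith
  have key : ∀ n : ℕ, n ≠ 0 →
      (g n : ℝ) ≤ K ^ (n.primeFactors.filter (· < p₀)).card * (n : ℝ) ^ ε := by
    intro n
    induction n using Nat.recOnPosPrimePosCoprime with
    | zero => intro h; exact absurd rfl h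
    | one => intro _; simpa using h_one
    | prime_pow p k hp hk =>
      intro _
      rw [Nat.primeFactors_prime_pow hk.ne' hp]
      by_cases hpp : p < p₀
      · rw [Finset.filter_singleton, if_pos hpp]
        simpa using hsmall p k hp
      · rw [Finset.filter_singleton, if_neg hpp]
        simpa using hlarge p k hp (not_lt.1 hpp) hk
    | coprime a b ha hb hab iha ihb =>
      intro _
      have iha := iha (by omega)
      have ihb := ihb (by omega)
      rw [hab.primeFactors_mul, Finset.filter_union, Finset.card_union_of_disjoint
        (Finset.disjoint_filter_filter hab.disjoint_primeFactors), pow_add, Nat.cast_mul,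
        Real.mul_rpow (by positivity) (by positivity)]
      calc (g (a * b) : ℝ) ≤ g a * g b := by exact_mod_cast h_mul a b (by omega) (by omega) hab
        _ ≤ (K ^ (a.primeFactors.filter (· < p₀)).card * (a : ℝ) ^ ε) *
            (K ^ (b.primeFactors.filter (· < p₀)).card * (b : ℝ) ^ ε) := by gcongr
        _ = _ := by ring
  refine ⟨K ^ p₀, one_le_pow₀ hK1, fun n hn => (key n hn).trans ?_⟩
  gcongr
  calc (n.primeFactors.filter (· < p₀)).card ≤ (Finset.range p₀).card :=
        Finset.card_le_card (fun x hx => Finset.mem_range.2 (Finset.mem_filter.1 hx).2)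
    _ = p₀ := Finset.card_range _

theorem exists_card_divisors_le_rpow {ε : ℝ} (hε : 0 < ε) :
    ∃ C : ℝ, 1 ≤ C ∧ ∀ n : ℕ, n ≠ 0 → (n.divisors.card : ℝ) ≤ C * (n : ℝ) ^ ε := by
  refine exists_le_mul_rpow_of_submultiplicative (fun n => n.divisors.card) (by simp)
    (fun m n _ _ hmn => hmn.card_divisors_mul.le) (fun p k hp => ?_) hε
  rw [Nat.divisors_prime_pow hp]
  simp only [Finset.card_map, Finset.card_range]
  omega

/-- The number of residues modulo `n` whose fourth power is `1`. -/
def fourthRootCount (n : ℕ) : ℕ := Nat.card {u : ZMod n // u ^ 4 = 1}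

theorem fourthRootCount_mul_le {m n : ℕ} (hm : 0 < m) (hn : 0 < n) (hmn : m.Coprime n) :
    fourthRootCount (m * n) ≤ fourthRootCount m * fourthRootCount n := by
  have : NeZero m := ⟨hm.ne'⟩
  have : NeZero n := ⟨hn.ne'⟩
  unfold fourthRootCount
  rw [← Nat.card_prod]
  let φ := ZMod.chineseRemainder hmn
  refine Nat.card_le_card_of_injective (fun u => (⟨(φ u.1).1, ?_⟩, ⟨(φ u.1).2, ?_⟩)) ?_
  · rw [← Prod.pow_fst, ← map_pow, u.2, map_one, Prod.fst_one]
  · rw [← Prod.pow_snd, ← map_pow, u.2, map_one, Prod.snd_one]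
  · intro u v huv
    simp only [Prod.mk.injEq, Subtype.mk.injEq] at huv
    exact Subtype.ext (φ.injective (Prod.ext huv.1 huv.2))

theorem fourthRootCount_prime_pow_le {p : ℕ} (k : ℕ) (hp : p.Prime) (hp2 : p ≠ 2) :
    fourthRootCount (p ^ k) ≤ 4 := by
  classical
  have : NeZero (p ^ k) := ⟨(pow_pos hp.pos k).ne'⟩
  have : IsCyclic (ZMod (p ^ k))ˣ := ZMod.isCyclic_units_of_prime_pow p hp hp2 k
  refine le_trans ?_ (IsCyclic.card_pow_eq_one_le (α := (ZMod (p ^ k))ˣ) (n := 4) (by norm_num))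
  rw [← Fintype.card_subtype, ← Nat.card_eq_fintype_card]
  refine Nat.card_le_card_of_injective
    (fun u => ⟨Units.ofPowEqOne u.1 4 u.2 (by norm_num), Units.pow_ofPowEqOne _ _⟩) ?_
  intro u v huv
  have := congrArg (fun w => ((w.1 : (ZMod (p ^ k))ˣ) : ZMod (p ^ k))) huv
  exact Subtype.ext (by simpa using this)

theorem fourthRootCount_two_pow_le (k : ℕ) : fourthRootCount (2 ^ k) ≤ 8 := by
  classical
  have : NeZero (2 ^ k) := ⟨(pow_pos two_pos k).ne'⟩
  rcases Nat.lt_or_ge k 3 with hk | hk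
  · have h1 : fourthRootCount (2 ^ k) ≤ Nat.card (ZMod (2 ^ k)) :=
      Nat.card_le_card_of_injective _ Subtype.val_injective
    rw [Nat.card_zmod] at h1
    have h2 : 2 ^ k ≤ 2 ^ 2 := Nat.pow_le_pow_right (by norm_num) (by omega)
    omega
  obtain ⟨j, rfl⟩ : ∃ j, k = j + 2 := ⟨k - 2, by omega⟩
  -- a fourth root of unity is congruent to `±1` modulo `2 ^ j`
  have key : ∀ u : ZMod (2 ^ (j + 2)), u ^ 4 = 1 →
      ((u.val : ZMod (2 ^ j)) = 1 ∨ (u.val : ZMod (2 ^ j)) = -1) := by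
    intro u hu
    obtain ⟨x, hx⟩ : ∃ x : ℤ, x = ((u.val : ℕ) : ℤ) := ⟨_, rfl⟩
    have hdvd : (2 : ℤ) ^ (j + 2) ∣ x ^ 4 - 1 := by
      have h0 : (((x ^ 4 - 1 : ℤ)) : ZMod (2 ^ (j + 2))) = 0 := by
        push_cast
        rw [hx]
        simp [hu]
      exact_mod_cast (ZMod.intCast_zmod_eq_zero_iff_dvd _ _).1 h0
    have hodd : x % 2 = 1 := by
      by_contra hc
      have h2 : (2 : ℤ) ∣ x := by omega
      have h3 : (2 : ℤ) ∣ x ^ 4 - 1 := (dvd_pow_self 2 (by omega)).trans hdvd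
      have h4 : (2 : ℤ) ∣ x ^ 4 := dvd_pow h2 (by norm_num)
      omega
    have hcop : ∀ w : ℤ, w % 2 = 1 → IsCoprime ((2 : ℤ) ^ j) w := by
      intro w hw
      apply IsCoprime.pow_left
      rcases Int.odd_iff.2 hw with ⟨m, rfl⟩
      exact ⟨-m, 1, by ring⟩
    have aux : ∀ y A B : ℤ, x ^ 4 - 1 = 4 * (y * (A * B)) → A % 2 = 1 → B % 2 = 1 →
        (2 : ℤ) ^ j ∣ y := by
      intro y A B h hA hB
      rw [h, pow_add, mul_comm, show (2 : ℤ) ^ 2 = 4 by norm_num,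
        mul_dvd_mul_iff_left (by norm_num)] at hdvd
      exact ((hcop A hA).mul_right (hcop B hB)).dvd_of_dvd_mul_right hdvd
    have hz : ∀ y : ℤ, (2 : ℤ) ^ j ∣ y → ((y : ℤ) : ZMod (2 ^ j)) = 0 := by
      intro y hy
      exact (ZMod.intCast_zmod_eq_zero_iff_dvd _ _).2 (by exact_mod_cast hy)
    have hcast : ((x : ℤ) : ZMod (2 ^ j)) = (u.val : ZMod (2 ^ j)) := by rw [hx]; simp
    rcases (show x % 4 = 1 ∨ x % 4 = 3 by omega) with h | h
    · obtain ⟨m, hm⟩ : ∃ m, x = 4 * m + 1 := ⟨x / 4, by omega⟩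
      left
      have := hz _ (aux (x - 1) (2 * m + 1) (8 * m ^ 2 + 4 * m + 1) (by rw [hm]; ring)
        (by omega) (by omega))
      push_cast at this
      rw [← hcast]
      exact sub_eq_zero.1 this
    · obtain ⟨m, hm⟩ : ∃ m, x = 4 * m + 3 := ⟨x / 4, by omega⟩
      right
      have := hz _ (aux (x + 1) (2 * m + 1) (8 * m ^ 2 + 12 * m + 5) (by rw [hm]; ring)
        (by omega) (by omega))
      push_cast at this
      rw [← hcast]
      exact eq_neg_of_add_eq_zero_left this
  have h1 : fourthRootCount (2 ^ (j + 2)) ≤ Nat.card (Fin 2 × Fin 4) := by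
    refine Nat.card_le_card_of_injective (fun u =>
      ((if (u.1.val : ZMod (2 ^ j)) = 1 then 0 else 1 : Fin 2),
        ⟨u.1.val / 2 ^ j, Nat.div_lt_of_lt_mul (by
          calc u.1.val < 2 ^ (j + 2) := ZMod.val_lt u.1
            _ = 2 ^ j * 4 := by rw [pow_add]; norm_num)⟩)) ?_
    intro u v huv
    simp only [Prod.mk.injEq, Fin.mk.injEq] at huv
    have h3 : (u.1.val : ZMod (2 ^ j)) = (v.1.val : ZMod (2 ^ j)) := by
      have hu := key u.1 u.2
      have hv := key v.1 v.2
      have h := huv.1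
      split_ifs at h with c1 c2 c2
      · rw [c1, c2]
      · exact absurd h (by decide)
      · exact absurd h (by decide)
      · rw [hu.resolve_left c1, hv.resolve_left c2]
    have h4 : u.1.val % 2 ^ j = v.1.val % 2 ^ j := (ZMod.natCast_eq_natCast_iff' _ _ _).1 h3
    apply Subtype.ext
    apply ZMod.val_injective
    rw [← Nat.div_add_mod u.1.val (2 ^ j), ← Nat.div_add_mod v.1.val (2 ^ j), h4, huv.2]
  simpa using h1

theorem exists_fourthRootCount_le_rpow {ε : ℝ} (hε : 0 < ε) :
    ∃ C : ℝ, 1 ≤ C ∧ ∀ n : ℕ, n ≠ 0 → (fourthRootCount n : ℝ) ≤ C * (n : ℝ) ^ ε := by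
  refine exists_le_mul_rpow_of_submultiplicative fourthRootCount ?_
    (fun m n hm hn hmn => fourthRootCount_mul_le hm hn hmn) (fun p k hp => ?_) hε
  · have : fourthRootCount 1 ≤ Nat.card (ZMod 1) :=
      Nat.card_le_card_of_injective _ Subtype.val_injective
    simpa using this
  · by_cases hp2 : p = 2
    · subst hp2
      have := fourthRootCount_two_pow_le k
      omega
    · have := fourthRootCount_prime_pow_le k hp hp2
      omega

theorem e_add (x y : ℝ) : e (x + y) = e x * e y := by
  simp only [e, ← Complex.exp_add]
  congr 1
  push_cast
  ring

theorem norm_e (x : ℝ) : ‖e x‖ = 1 := by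
  rw [e, show 2 * (π : ℂ) * Complex.I * x = ((2 * π * x : ℝ) : ℂ) * Complex.I by push_cast; ring]
  exact Complex.norm_exp_ofReal_mul_I _

theorem conj_e (x : ℝ) : (starRingEnd ℂ) (e x) = e (-x) := by
  rw [e, e, ← Complex.exp_conj]
  congr 1
  simp only [map_mul, Complex.conj_ofReal, Complex.conj_I, map_ofNat]
  push_cast
  ring

theorem norm_e_sub_one (x : ℝ) : 4 * |x - round x| ≤ ‖e x - 1‖ := by
  have h1 : e x = Complex.exp (Complex.I * ((2 * π * (x - round x) : ℝ) : ℂ)) := by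
    rw [e, show Complex.I * ((2 * π * (x - round x) : ℝ) : ℂ) =
      2 * π * Complex.I * x - (round x : ℂ) * (2 * π * Complex.I) by push_cast; ring]
    rw [Complex.exp_periodic.sub_int_mul_eq]
  rw [h1, Complex.norm_exp_I_mul_ofReal_sub_one, norm_mul, Real.norm_eq_abs, Real.norm_eq_abs,
    abs_two, show 2 * π * (x - round x) / 2 = π * (x - round x) by ring]
  have h2 := abs_sub_round x
  have h3 := Real.mul_abs_le_abs_sin (x := π * (x - round x)) (by
    rw [abs_mul, abs_of_pos Real.pi_pos]
    nlinarith [Real.pi_pos])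
  rw [abs_mul, abs_of_pos Real.pi_pos] at h3
  have h4 : 2 / π * (π * |x - round x|) = 2 * |x - round x| := by
    have := Real.pi_pos
    field_simp
  linarith

theorem sum_Icc_int_sub (f : ℤ → ℂ) {a b : ℤ} (hab : a ≤ b) :
    ∑ x ∈ Finset.Icc a b, (f (x + 1) - f x) = f (b + 1) - f a := by
  induction b, hab using Int.leInduction with
  | base => simp
  | succ n hn ih =>
    rw [← Finset.insert_Icc_right_eq_Icc_add_one (by omega), Finset.sum_insert (by simp), ih]
    ring

theorem norm_sum_Icc_e_linear_mul_le (θ c : ℝ) (a b : ℤ) :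
    ‖∑ x ∈ Finset.Icc a b, e (θ * x + c)‖ * |θ - round θ| ≤ 1 := by
  rcases lt_or_ge b a with hab | hab
  · simp [Finset.Icc_eq_empty (not_le.2 hab)]
  have h1 : (e θ - 1) * ∑ x ∈ Finset.Icc a b, e (θ * x + c) =
      e (θ * (b + 1 : ℤ) + c) - e (θ * a + c) := by
    rw [← sum_Icc_int_sub (fun x : ℤ => e (θ * x + c)) hab, Finset.mul_sum]
    refine Finset.sum_congr rfl fun x _ => ?_
    rw [show θ * ((x + 1 : ℤ) : ℝ) + c = θ + (θ * x + c) by push_cast; ring, e_add θ]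
    ring
  have h2 : ‖e θ - 1‖ * ‖∑ x ∈ Finset.Icc a b, e (θ * x + c)‖ ≤ 2 := by
    rw [← norm_mul, h1]
    refine (norm_sub_le _ _).trans ?_
    rw [norm_e, norm_e]
    norm_num
  have h3 := norm_e_sub_one θ
  have h4 := norm_nonneg (∑ x ∈ Finset.Icc a b, e (θ * x + c))
  nlinarith

/-- Multiplicative differencing. -/
def diffMul (F : ℤ → ℂ) (k : ℤ) : ℤ → ℂ := fun x => F (x + k) * (starRingEnd ℂ) (F x)

theorem norm_sum_Icc_sq_le (F : ℤ → ℂ) {a b : ℤ} {M : ℕ} (hab : b - a < M) :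
    ‖∑ x ∈ Finset.Icc a b, F x‖ ^ 2 ≤ ∑ k ∈ Finset.Ioo (-(M : ℤ)) M,
      ‖∑ x ∈ Finset.Icc (max a (a - k)) (min b (b - k)), diffMul F k x‖ := by
  have h1 : ‖∑ x ∈ Finset.Icc a b, F x‖ ^ 2 =
      ‖(∑ x ∈ Finset.Icc a b, F x) * (starRingEnd ℂ) (∑ x ∈ Finset.Icc a b, F x)‖ := by
    rw [norm_mul, RCLike.norm_conj, sq]
  have h2 : (∑ x ∈ Finset.Icc a b, F x) * (starRingEnd ℂ) (∑ x ∈ Finset.Icc a b, F x) =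
      ∑ k ∈ Finset.Ioo (-(M : ℤ)) M,
        ∑ x ∈ Finset.Icc (max a (a - k)) (min b (b - k)), diffMul F k x := by
    rw [map_sum, Finset.sum_mul_sum, ← Finset.sum_product', Finset.sum_sigma']
    refine Finset.sum_bij' (fun p _ => ⟨p.1 - p.2, p.2⟩) (fun s _ => (s.2 + s.1, s.2)) ?_ ?_ ?_ ?_ ?_
    · rintro ⟨y, x⟩ h
      simp only [Finset.mem_product, Finset.mem_Icc, Finset.mem_sigma, Finset.mem_Ioo, max_le_iff,
        le_min_iff] at h ⊢
      omega
    · rintro ⟨k, x⟩ h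
      simp only [Finset.mem_product, Finset.mem_Icc, Finset.mem_sigma, Finset.mem_Ioo, max_le_iff,
        le_min_iff] at h ⊢
      omega
    · rintro ⟨y, x⟩ _
      simp
    · rintro ⟨k, x⟩ _
      simp
    · rintro ⟨y, x⟩ _
      simp [diffMul]
  rw [h1, h2]
  exact norm_sum_le _ _

theorem norm_sum_Icc_pow_eight_le (F : ℤ → ℂ) {a b : ℤ} {M : ℕ} (hab : b - a < M) :
    ‖∑ x ∈ Finset.Icc a b, F x‖ ^ 8 ≤ 16 * (M : ℝ) ^ 4 *
      ∑ k ∈ Finset.Ioo (-(M : ℤ)) M, ∑ l ∈ Finset.Ioo (-(M : ℤ)) M,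
        ∑ m ∈ Finset.Ioo (-(M : ℤ)) M,
          ‖∑ x ∈ Finset.Icc (max (max (max a (a - k)) (max a (a - k) - l))
              (max (max a (a - k)) (max a (a - k) - l) - m))
            (min (min (min b (b - k)) (min b (b - k) - l))
              (min (min b (b - k)) (min b (b - k) - l) - m)),
            diffMul (diffMul (diffMul F k) l) m x‖ := by
  set I := Finset.Ioo (-(M : ℤ)) M with hI
  have hIc : (I.card : ℝ) ≤ 2 * M := by
    have : I.card ≤ 2 * M := by rw [hI, Int.card_Ioo]; omega
    exact_mod_cast this
  set u : ℤ → ℝ := fun k =>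
    ‖∑ x ∈ Finset.Icc (max a (a - k)) (min b (b - k)), diffMul F k x‖ with hu
  set v : ℤ → ℤ → ℝ := fun k l =>
    ‖∑ x ∈ Finset.Icc (max (max a (a - k)) (max a (a - k) - l))
      (min (min b (b - k)) (min b (b - k) - l)), diffMul (diffMul F k) l x‖ with hv
  have h1 : ‖∑ x ∈ Finset.Icc a b, F x‖ ^ 2 ≤ ∑ k ∈ I, u k := norm_sum_Icc_sq_le F hab
  have h2 : ∀ k, u k ^ 2 ≤ ∑ l ∈ I, v k l := fun k => norm_sum_Icc_sq_le _ (by omega)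
  have h4 : ‖∑ x ∈ Finset.Icc a b, F x‖ ^ 4 ≤ 2 * M * ∑ k ∈ I, ∑ l ∈ I, v k l := by
    calc ‖∑ x ∈ Finset.Icc a b, F x‖ ^ 4 = (‖∑ x ∈ Finset.Icc a b, F x‖ ^ 2) ^ 2 := by ring
      _ ≤ (∑ k ∈ I, u k) ^ 2 := by gcongr
      _ ≤ I.card * ∑ k ∈ I, u k ^ 2 := sq_sum_le_card_mul_sum_sq
      _ ≤ 2 * M * ∑ k ∈ I, ∑ l ∈ I, v k l := by
        gcongr with k
        exact h2 k
  have h5 : (∑ k ∈ I, ∑ l ∈ I, v k l) ^ 2 ≤ (2 * M) * (2 * M) * ∑ k ∈ I, ∑ l ∈ I, v k l ^ 2 := by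
    calc (∑ k ∈ I, ∑ l ∈ I, v k l) ^ 2 ≤ I.card * ∑ k ∈ I, (∑ l ∈ I, v k l) ^ 2 :=
          sq_sum_le_card_mul_sum_sq
      _ ≤ I.card * ∑ k ∈ I, (I.card * ∑ l ∈ I, v k l ^ 2) := by
        gcongr
        exact sq_sum_le_card_mul_sum_sq
      _ = I.card * I.card * ∑ k ∈ I, ∑ l ∈ I, v k l ^ 2 := by rw [← Finset.mul_sum]; ring
      _ ≤ _ := by gcongr
  calc ‖∑ x ∈ Finset.Icc a b, F x‖ ^ 8 = (‖∑ x ∈ Finset.Icc a b, F x‖ ^ 4) ^ 2 := by ring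
    _ ≤ (2 * M * ∑ k ∈ I, ∑ l ∈ I, v k l) ^ 2 := by gcongr
    _ = (2 * M) ^ 2 * (∑ k ∈ I, ∑ l ∈ I, v k l) ^ 2 := by ring
    _ ≤ (2 * M) ^ 2 * ((2 * M) * (2 * M) * ∑ k ∈ I, ∑ l ∈ I, v k l ^ 2) := by gcongr
    _ = 16 * (M : ℝ) ^ 4 * ∑ k ∈ I, ∑ l ∈ I, v k l ^ 2 := by ring
    _ ≤ _ := by
      gcongr with k _ l _
      exact norm_sum_Icc_sq_le _ (by omega)

theorem diffMul_fourth_power (γ : ℝ) (k l m x : ℤ) :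
    diffMul (diffMul (diffMul (fun x : ℤ => e (γ * x ^ 4)) k) l) m x =
      e (k * l * m * (24 * γ) * x + 12 * γ * k * l * m * (k + l + m)) := by
  simp only [diffMul, conj_e, ← e_add]
  congr 1
  push_cast
  ring

theorem exists_many_triples_of_large_weyl_sum {M : ℕ} {γ U : ℝ} (hM : 0 < M) (hU : 0 < U)
    (hlarge : M / U ≤ ‖∑ x ∈ Finset.Icc (1 : ℤ) M, e (γ * x ^ 4)‖) :
    ∃ S ⊆ (Finset.Ioo (-(M : ℤ)) M ×ˢ Finset.Ioo (-(M : ℤ)) M) ×ˢ Finset.Ioo (-(M : ℤ)) M,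
      1 / (32 * U ^ 8) * M ^ 3 ≤ S.card ∧
      ∀ s ∈ S, ∃ z : ℤ, |s.1.1 * s.1.2 * s.2 * (24 * γ) - z| ≤ 256 * U ^ 8 / M := by
  have hM0 : (0 : ℝ) < M := by exact_mod_cast hM
  set I := Finset.Ioo (-(M : ℤ)) M with hI
  have hIc : (I.card : ℝ) ≤ 2 * M := by
    have : I.card ≤ 2 * M := by rw [hI, Int.card_Ioo]; omega
    exact_mod_cast this
  have hw := norm_sum_Icc_pow_eight_le (fun x : ℤ => e (γ * x ^ 4)) (a := 1) (b := M) (M := M)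
    (by omega)
  set w : ℤ → ℤ → ℤ → ℝ := fun k l m =>
    ‖∑ x ∈ Finset.Icc (max (max (max 1 (1 - k)) (max 1 (1 - k) - l))
        (max (max 1 (1 - k)) (max 1 (1 - k) - l) - m))
      (min (min (min (M : ℤ) (M - k)) (min (M : ℤ) (M - k) - l))
        (min (min (M : ℤ) (M - k)) (min (M : ℤ) (M - k) - l) - m)),
      diffMul (diffMul (diffMul (fun x : ℤ => e (γ * x ^ 4)) k) l) m x‖ with hwdef
  have hw' : (M / U) ^ 8 ≤ 16 * (M : ℝ) ^ 4 * ∑ s ∈ (I ×ˢ I) ×ˢ I, w s.1.1 s.1.2 s.2 := by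
    rw [Finset.sum_product, Finset.sum_product]
    exact (pow_le_pow_left₀ (by positivity) hlarge 8).trans hw
  have hwM : ∀ k l m, w k l m ≤ M := by
    intro k l m
    simp only [hwdef, diffMul_fourth_power]
    refine (norm_sum_le _ _).trans ?_
    simp only [norm_e, Finset.sum_const, nsmul_eq_mul, mul_one, Int.card_Icc]
    exact_mod_cast (show _ ≤ M by omega)
  have hwround : ∀ k l m : ℤ, w k l m *
      |k * l * m * (24 * γ) - round (k * l * m * (24 * γ))| ≤ 1 := by
    intro k l m
    simp only [hwdef, diffMul_fourth_power]
    exact norm_sum_Icc_e_linear_mul_le _ _ _ _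
  set S := ((I ×ˢ I) ×ˢ I).filter (fun s => M / (256 * U ^ 8) ≤ w s.1.1 s.1.2 s.2) with hS
  refine ⟨S, Finset.filter_subset _ _, ?_, ?_⟩
  · have h1 : ∑ s ∈ (I ×ˢ I) ×ˢ I, w s.1.1 s.1.2 s.2 ≤
        S.card * M + 8 * M ^ 3 * (M / (256 * U ^ 8)) := by
      rw [← Finset.sum_filter_add_sum_filter_not _ (fun s => M / (256 * U ^ 8) ≤ w s.1.1 s.1.2 s.2)]
      apply add_le_add
      · rw [← nsmul_eq_mul]
        exact Finset.sum_le_card_nsmul _ _ _ (fun s _ => hwM _ _ _)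
      · refine (Finset.sum_le_card_nsmul _ _ (M / (256 * U ^ 8)) (fun s hs =>
          (not_le.1 (Finset.mem_filter.1 hs).2).le)).trans ?_
        rw [nsmul_eq_mul]
        gcongr
        refine (Nat.cast_le.2 (Finset.card_filter_le _ _)).trans ?_
        rw [Finset.card_product, Finset.card_product]
        push_cast
        calc (I.card : ℝ) * I.card * I.card ≤ 2 * M * (2 * M) * (2 * M) := by gcongr
          _ = _ := by ring
    have h2 : (M / U) ^ 8 ≤ 16 * (M : ℝ) ^ 4 * (S.card * M + 8 * M ^ 3 * (M / (256 * U ^ 8))) :=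
      hw'.trans (by gcongr)
    have h3 : (M / U) ^ 8 = (M : ℝ) ^ 5 * (M ^ 3 / U ^ 8) := by field_simp
    have h4 : 16 * (M : ℝ) ^ 4 * (S.card * M + 8 * M ^ 3 * (M / (256 * U ^ 8))) =
        M ^ 5 * (16 * S.card + M ^ 3 / (2 * U ^ 8)) := by field_simp; ring
    rw [h3, h4] at h2
    have h5 := le_of_mul_le_mul_left h2 (by positivity)
    have h6 : (M : ℝ) ^ 3 / U ^ 8 = 32 * (1 / (32 * U ^ 8) * M ^ 3) := by field_simp
    have h7 : (M : ℝ) ^ 3 / (2 * U ^ 8) = 16 * (1 / (32 * U ^ 8) * M ^ 3) := by field_simp; norm_num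
    linarith
  · intro s hs
    have h1 := (Finset.mem_filter.1 hs).2
    refine ⟨round ((s.1.1 : ℝ) * s.1.2 * s.2 * (24 * γ)), ?_⟩
    · have h2 := hwround s.1.1 s.1.2 s.2
      have h3 : M / (256 * U ^ 8) * |s.1.1 * s.1.2 * s.2 * (24 * γ) -
          round (s.1.1 * s.1.2 * s.2 * (24 * γ))| ≤ 1 :=
        (mul_le_mul_of_nonneg_right h1 (abs_nonneg _)).trans h2
      rw [div_mul_eq_mul_div, div_le_one (by positivity)] at h3
      rw [le_div_iff₀ hM0]
      linarith

theorem card_filter_dvd_mul_le {M c d : ℕ} (hc : 0 < c) (hd : 0 < d) (hdM : d ≤ M) :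
    (((Finset.Ioo (-(M : ℤ)) M).filter (fun x => (d : ℤ) ∣ c * x)).card : ℝ) ≤ 3 * c * M / d := by
  have hd0 : (0 : ℝ) < d := by exact_mod_cast hd
  have hc1 : (1 : ℝ) ≤ c := by exact_mod_cast hc
  have hdM' : (d : ℝ) ≤ M := by exact_mod_cast hdM
  have h1 : ((Finset.Ioo (-(M : ℤ)) M).filter (fun x => (d : ℤ) ∣ c * x)).card ≤
      (Finset.Icc (-((c * M / d : ℕ) : ℤ)) (c * M / d : ℕ)).card := by
    refine Finset.card_le_card_of_injOn (fun x => (c : ℤ) * x / d) ?_ ?_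
    · intro x hx
      simp only [Finset.coe_filter, Finset.mem_Ioo, Set.mem_ofPred_eq, Finset.coe_Icc,
        Set.mem_Icc] at hx ⊢
      obtain ⟨⟨hx1, hx2⟩, k, hk⟩ := hx
      have hc' : (0 : ℤ) < c := by exact_mod_cast hc
      have hd' : (0 : ℤ) < d := by exact_mod_cast hd
      rw [hk, Int.mul_ediv_cancel_left _ hd'.ne', ← abs_le]
      push_cast
      rw [Int.le_ediv_iff_mul_le hd', mul_comm |k|, ← abs_of_pos hd', ← abs_mul,
        ← hk, abs_mul, abs_of_pos hc']
      exact mul_le_mul_of_nonneg_left (abs_lt.2 ⟨hx1, hx2⟩).le hc'.le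
    · intro x hx y hy hxy
      have hx := (Finset.mem_filter.1 hx).2
      have hy := (Finset.mem_filter.1 hy).2
      have h2 := (Int.ediv_left_inj hx hy).1 hxy
      simpa [hc.ne'] using h2
  have h2 : ((Finset.Icc (-((c * M / d : ℕ) : ℤ)) (c * M / d : ℕ)).card : ℝ) ≤
      2 * (c * M / d : ℕ) + 1 := by
    rw [Int.card_Icc]
    exact_mod_cast (show _ ≤ 2 * (c * M / d) + 1 by omega)
  have h3 : ((c * M / d : ℕ) : ℝ) ≤ c * M / d := by
    refine Nat.cast_div_le.trans (le_of_eq ?_)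
    push_cast
    ring
  have h4 : (1 : ℝ) ≤ c * M / d := by
    rw [le_div_iff₀ hd0]
    nlinarith
  have h5 : (((Finset.Ioo (-(M : ℤ)) M).filter (fun x => (d : ℤ) ∣ c * x)).card : ℝ) ≤
      ((Finset.Icc (-((c * M / d : ℕ) : ℤ)) (c * M / d : ℕ)).card : ℝ) := by exact_mod_cast h1
  calc _ ≤ 2 * (c * M / d : ℝ) + c * M / d := by linarith
    _ = _ := by ring

theorem card_filter_abs_lt_le (s : Finset ℤ) {K : ℝ} (hK : 0 ≤ K) :
    ((s.filter (fun x : ℤ => |(x : ℝ)| < K)).card : ℝ) ≤ 2 * K + 1 := by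
  have h1 : s.filter (fun x : ℤ => |(x : ℝ)| < K) ⊆ Finset.Icc (-⌊K⌋) ⌊K⌋ := by
    intro x hx
    have := (abs_lt.1 (Finset.mem_filter.1 hx).2)
    rw [Finset.mem_Icc]
    constructor
    · have : -x ≤ ⌊K⌋ := Int.le_floor.2 (by push_cast; linarith)
      linarith
    · exact Int.le_floor.2 this.2.le
  have h0 : 0 ≤ ⌊K⌋ := Int.floor_nonneg.2 hK
  have h2 := Finset.card_le_card h1
  rw [Int.card_Icc] at h2
  have h3 : ((s.filter (fun x : ℤ => |(x : ℝ)| < K)).card : ℤ) ≤ 2 * ⌊K⌋ + 1 := by omega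
  have h4 := Int.floor_le K
  have h5 : ((s.filter (fun x : ℤ => |(x : ℝ)| < K)).card : ℝ) ≤ 2 * ⌊K⌋ + 1 := by exact_mod_cast h3
  linarith

theorem card_triples_dvd_le {M c r : ℕ} (hc : 0 < c) (hr : 0 < r) (hrM : r ≤ M) :
    ((((Finset.Ioo (-(M : ℤ)) M ×ˢ Finset.Ioo (-(M : ℤ)) M) ×ˢ Finset.Ioo (-(M : ℤ)) M).filter
      (fun s => (r : ℤ) ∣ c * s.1.1 * s.1.2 * s.2)).card : ℝ) ≤
      27 * c * (r.divisors.card : ℝ) ^ 3 * M ^ 3 / r := by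
  set I := Finset.Ioo (-(M : ℤ)) M with hI
  set D := ((r.divisors ×ˢ r.divisors) ×ˢ r.divisors).filter (fun d => d.1.1 * d.1.2 * d.2 = r)
    with hD
  have hr0 : (0 : ℝ) < r := by exact_mod_cast hr
  have h1 : ((I ×ˢ I) ×ˢ I).filter (fun s => (r : ℤ) ∣ c * s.1.1 * s.1.2 * s.2) ⊆
      D.biUnion (fun d => (I.filter (fun x => (d.1.1 : ℤ) ∣ c * x) ×ˢ
        I.filter (fun x => (d.1.2 : ℤ) ∣ (1 : ℕ) * x)) ×ˢ
        I.filter (fun x => (d.2 : ℤ) ∣ (1 : ℕ) * x)) := by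
    rintro ⟨⟨x, y⟩, z⟩ hs
    simp only [Finset.mem_filter, Finset.mem_product] at hs
    obtain ⟨⟨⟨hx, hy⟩, hz⟩, hdvd⟩ := hs
    obtain ⟨a, d3, ha, hd3, hr1⟩ := exists_dvd_and_dvd_of_dvd_mul hdvd
    obtain ⟨d1, d2, hd1, hd2, ha'⟩ := exists_dvd_and_dvd_of_dvd_mul ha
    have hprod : d1.natAbs * d2.natAbs * d3.natAbs = r := by
      rw [← Int.natAbs_mul, ← Int.natAbs_mul, ← ha', ← hr1, Int.natAbs_natCast]
    simp only [Finset.mem_biUnion, Finset.mem_filter, Finset.mem_product, hD, Nat.mem_divisors]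
    refine ⟨((d1.natAbs, d2.natAbs), d3.natAbs), ⟨⟨⟨⟨?_, hr.ne'⟩, ⟨?_, hr.ne'⟩⟩, ⟨?_, hr.ne'⟩⟩, hprod⟩,
      ⟨⟨hx, ?_⟩, ⟨hy, ?_⟩⟩, ⟨hz, ?_⟩⟩
    · exact ⟨d2.natAbs * d3.natAbs, by rw [← hprod]; ring⟩
    · exact ⟨d1.natAbs * d3.natAbs, by rw [← hprod]; ring⟩
    · exact ⟨d1.natAbs * d2.natAbs, by rw [← hprod]; ring⟩
    · simpa using hd1
    · simpa using hd2
    · simpa using hd3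
  have h2 : (D.card : ℝ) ≤ (r.divisors.card : ℝ) ^ 3 := by
    have := Finset.card_filter_le ((r.divisors ×ˢ r.divisors) ×ˢ r.divisors)
      (fun d => d.1.1 * d.1.2 * d.2 = r)
    rw [Finset.card_product, Finset.card_product] at this
    calc (D.card : ℝ) ≤ ((r.divisors.card * r.divisors.card * r.divisors.card : ℕ) : ℝ) := by
          exact_mod_cast this
      _ = _ := by push_cast; ring
  have h3 : ∀ d ∈ D, (((I.filter (fun x => (d.1.1 : ℤ) ∣ c * x) ×ˢ
        I.filter (fun x => (d.1.2 : ℤ) ∣ (1 : ℕ) * x)) ×ˢ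
        I.filter (fun x => (d.2 : ℤ) ∣ (1 : ℕ) * x)).card : ℝ) ≤ 27 * c * M ^ 3 / r := by
    intro d hd
    simp only [hD, Finset.mem_filter, Finset.mem_product, Nat.mem_divisors] at hd
    have hle : ∀ k, k ∣ r → 0 < k ∧ k ≤ M := fun k hk =>
      ⟨Nat.pos_of_dvd_of_pos hk hr, (Nat.le_of_dvd hr hk).trans hrM⟩
    have e1 := hle _ hd.1.1.1.1
    have e2 := hle _ hd.1.1.2.1
    have e3 := hle _ hd.1.2.1
    have f1 := card_filter_dvd_mul_le hc e1.1 e1.2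
    have f2 := card_filter_dvd_mul_le one_pos e2.1 e2.2
    have f3 := card_filter_dvd_mul_le one_pos e3.1 e3.2
    rw [Finset.card_product, Finset.card_product]
    push_cast [Nat.cast_one] at f1 f2 f3 ⊢
    have g1 : (0 : ℝ) < d.1.1 := by exact_mod_cast e1.1
    have g2 : (0 : ℝ) < d.1.2 := by exact_mod_cast e2.1
    have g3 : (0 : ℝ) < d.2 := by exact_mod_cast e3.1
    refine (mul_le_mul (mul_le_mul f1 f2 (by positivity) (by positivity)) f3 (by positivity)
      (by positivity)).trans (le_of_eq ?_)
    rw [show (r : ℝ) = d.1.1 * d.1.2 * d.2 by exact_mod_cast hd.2.symm]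
    field_simp
    ring
  have h4 := (Finset.card_le_card h1).trans Finset.card_biUnion_le
  refine (Nat.cast_le.2 h4).trans ?_
  rw [Nat.cast_sum]
  calc _ ≤ D.card • (27 * c * M ^ 3 / r : ℝ) := Finset.sum_le_card_nsmul _ _ _ h3
    _ ≤ (r.divisors.card : ℝ) ^ 3 * (27 * c * M ^ 3 / r) := by
      rw [nsmul_eq_mul]
      gcongr
    _ = _ := by ring

theorem card_triples_some_abs_lt_le {M : ℕ} {K : ℝ} (hK : 0 ≤ K) :
    ((((Finset.Ioo (-(M : ℤ)) M ×ˢ Finset.Ioo (-(M : ℤ)) M) ×ˢ Finset.Ioo (-(M : ℤ)) M).filter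
      (fun s : (ℤ × ℤ) × ℤ => |(s.1.1 : ℝ)| < K ∨ |(s.1.2 : ℝ)| < K ∨ |(s.2 : ℝ)| < K)).card : ℝ) ≤
      12 * M ^ 2 * (2 * K + 1) := by
  set I := Finset.Ioo (-(M : ℤ)) M with hI
  set J := I.filter (fun x : ℤ => |(x : ℝ)| < K) with hJ
  have hIc : (I.card : ℝ) ≤ 2 * M := by
    have : I.card ≤ 2 * M := by rw [hI, Int.card_Ioo]; omega
    exact_mod_cast this
  have hJc : (J.card : ℝ) ≤ 2 * K + 1 := card_filter_abs_lt_le I hK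
  have h1 : ((I ×ˢ I) ×ˢ I).filter
      (fun s : (ℤ × ℤ) × ℤ => |(s.1.1 : ℝ)| < K ∨ |(s.1.2 : ℝ)| < K ∨ |(s.2 : ℝ)| < K) ⊆
      ((J ×ˢ I) ×ˢ I) ∪ (((I ×ˢ J) ×ˢ I) ∪ ((I ×ˢ I) ×ˢ J)) := by
    rintro ⟨⟨x, y⟩, z⟩ hs
    simp only [Finset.mem_filter, Finset.mem_product, Finset.mem_union, hJ] at hs ⊢
    tauto
  have h2 := (Finset.card_le_card h1).trans ((Finset.card_union_le _ _).trans
    (Nat.add_le_add_left (Finset.card_union_le _ _) _))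
  simp only [Finset.card_product] at h2
  have h3 := Nat.cast_le (α := ℝ) |>.2 h2
  refine h3.trans ?_
  push_cast
  have h4 : (I.card : ℝ) * I.card ≤ 4 * M ^ 2 := by
    calc (I.card : ℝ) * I.card ≤ 2 * M * (2 * M) := by gcongr
      _ = _ := by ring
  calc (J.card : ℝ) * I.card * I.card + (I.card * J.card * I.card + I.card * I.card * J.card)
      = 3 * ((I.card : ℝ) * I.card) * J.card := by ring
    _ ≤ 3 * (4 * M ^ 2) * (2 * K + 1) := by gcongr
    _ = _ := by ring

set_option maxHeartbeats 1000000 in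
theorem exists_rational_approx_of_large_weyl_sum :
    ∃ C : ℝ, 1 ≤ C ∧ ∀ (M : ℕ) (γ U : ℝ), 1 ≤ U → C * U ^ 120 ≤ M →
      M / U ≤ ‖∑ x ∈ Finset.Icc (1 : ℤ) M, e (γ * x ^ 4)‖ →
      ∃ (r : ℕ) (b : ℤ), 1 ≤ r ∧ r ≤ C * U ^ 9 ∧ |r * γ - b| ≤ C * U ^ 41 / M ^ 4 := by
  obtain ⟨C₀, hC₀, hdiv⟩ := exists_card_divisors_le_rpow (show (0 : ℝ) < 1 / 30 by norm_num)
  set C₁ : ℝ := (32 * 648 * C₀ ^ 3) ^ (10 / 9 : ℝ) with hC₁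
  have hC₁' : 1 ≤ C₁ := Real.one_le_rpow (by nlinarith [one_le_pow₀ hC₀ (n := 3)]) (by norm_num)
  refine ⟨10 ^ 80 * C₁, by nlinarith, fun M γ U hU hM hlarge => ?_⟩
  have hU0 : 0 < U := by linarith
  have hMU : 10 ^ 80 * U ^ 120 ≤ M := by
    refine le_trans ?_ hM
    have : 0 < U ^ 120 := by positivity
    nlinarith
  have hM0 : (0 : ℝ) < M := lt_of_lt_of_le (by positivity) hMU
  have hMpos : 0 < M := by exact_mod_cast hM0
  have hpow : ∀ i, i ≤ 120 → 10 ^ 80 * U ^ i ≤ M := fun i hi =>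
    le_trans (by gcongr) hMU
  obtain ⟨S, hS, hcard, hnear⟩ := exists_many_triples_of_large_weyl_sum hMpos hU0 hlarge
  obtain ⟨t, ht1, ht, z, hz⟩ := exists_small_denominator_of_many_triples (θ := 24 * γ)
    (δ := 1 / (32 * U ^ 8)) (ε := 256 * U ^ 8 / M) hMpos (by positivity)
    (by
      rw [div_le_one (by positivity)]
      nlinarith [one_le_pow₀ hU (n := 8)])
    (by positivity)
    (by
      have := hpow 40 (by norm_num)
      rw [div_pow, one_pow, mul_div_assoc', div_le_div_iff₀ hM0 (by positivity)]
      have h2 : 0 < U ^ 40 := by positivity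
      nlinarith)
    (by
      have := hpow 32 (by norm_num)
      rw [div_pow, one_pow, div_mul_eq_mul_div, one_mul, le_div_iff₀ (by positivity)]
      have h2 : 0 < U ^ 32 := by positivity
      nlinarith) S hS hcard hnear
  set n : ℕ := 24 * t with hn
  have hn0 : 0 < n := by omega
  set ρ : ℚ := (z : ℚ) / n with hρ
  set r := ρ.den with hr
  set b := ρ.num with hb
  have hr0 : 0 < r := ρ.den_pos
  have hrn : r ≤ n := by
    have : (r : ℤ) ∣ (n : ℤ) := by
      have := Rat.den_dvd z n
      rw [Rat.divInt_eq_div] at this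
      simpa [hr, hρ] using this
    exact Nat.le_of_dvd hn0 (by exact_mod_cast this)
  have hρr : (b : ℝ) / r = z / n := by
    have h1 : ((ρ : ℚ) : ℝ) = (b : ℝ) / r := by rw [hb, hr, Rat.cast_def]
    rw [← h1, hρ]
    push_cast
    rfl
  have hr0' : (0 : ℝ) < r := by exact_mod_cast hr0
  have hn0' : (0 : ℝ) < n := by exact_mod_cast hn0
  have hnU : (n : ℝ) ≤ 10 ^ 34 * U ^ 56 := by
    rw [hn]
    push_cast
    have h2 : (10 : ℝ) ^ 20 / (1 / (32 * U ^ 8)) ^ 7 = 10 ^ 20 * 32 ^ 7 * U ^ 56 := by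
      field_simp
    rw [h2] at ht
    have : 0 < U ^ 56 := by positivity
    nlinarith
  have hrU : (r : ℝ) ≤ 10 ^ 34 * U ^ 56 := le_trans (by exact_mod_cast hrn) hnU
  set β : ℝ := γ - b / r with hβ
  have hβ1 : |β| ≤ 10 ^ 34 * U ^ 64 / M ^ 4 := by
    have h1 : n * β = t * (24 * γ) - z := by
      rw [hβ, hρr, hn]
      push_cast
      field_simp
    have h2 : |β| ≤ |n * β| := by
      rw [abs_mul, abs_of_pos hn0']
      have : (1 : ℝ) ≤ n := by exact_mod_cast hn0
      nlinarith [abs_nonneg β]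
    refine h2.trans ?_
    rw [h1]
    refine hz.trans ?_
    have h3 : 10 ^ 20 * (256 * U ^ 8 / M) / ((1 / (32 * U ^ 8)) ^ 7 * M ^ 3) =
        10 ^ 20 * 256 * 32 ^ 7 * U ^ 64 / M ^ 4 := by field_simp
    rw [h3]
    gcongr
    norm_num
  have hkey : ∀ s ∈ S, ((r : ℤ) ∣ (24 : ℕ) * s.1.1 * s.1.2 * s.2) ∧
      |24 * (s.1.1 * s.1.2 * s.2 : ℝ) * β| ≤ 256 * U ^ 8 / M := by
    intro s hs
    obtain ⟨w, hw⟩ := hnear s hs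
    have hsI := hS hs
    simp only [Finset.mem_product, Finset.mem_Ioo] at hsI
    have hab : ∀ x : ℤ, -(M : ℤ) < x ∧ x < M → |(x : ℝ)| ≤ M := by
      intro x hx
      have := (abs_lt.2 hx).le
      exact_mod_cast this
    have h1 : |24 * (s.1.1 * s.1.2 * s.2 : ℝ)| ≤ 24 * M ^ 3 := by
      rw [abs_mul, abs_mul, abs_mul, abs_of_pos (show (0 : ℝ) < 24 by norm_num)]
      have := mul_le_mul (mul_le_mul (hab _ hsI.1.1) (hab _ hsI.1.2) (abs_nonneg _) hM0.le)
        (hab _ hsI.2) (abs_nonneg _) (by positivity)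
      calc _ ≤ 24 * ((M : ℝ) * M * M) := by linarith
        _ = _ := by ring
    have h2 : |24 * (s.1.1 * s.1.2 * s.2 : ℝ) * β| ≤ 10 ^ 36 * U ^ 64 / M := by
      rw [abs_mul]
      refine (mul_le_mul h1 hβ1 (abs_nonneg _) (by positivity)).trans ?_
      rw [show 24 * (M : ℝ) ^ 3 * (10 ^ 34 * U ^ 64 / M ^ 4) = 24 * 10 ^ 34 * U ^ 64 / M by
        field_simp]
      gcongr
      norm_num
    have h3 : ((24 * (s.1.1 * s.1.2 * s.2) * b - w * r : ℤ) : ℝ) =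
        r * ((s.1.1 * s.1.2 * s.2 * (24 * γ) - w) - 24 * (s.1.1 * s.1.2 * s.2 : ℝ) * β) := by
      rw [hβ]
      push_cast
      field_simp
      ring
    have h4 : |((24 * (s.1.1 * s.1.2 * s.2) * b - w * r : ℤ) : ℝ)| < 1 := by
      rw [h3, abs_mul, abs_of_pos hr0']
      calc _ ≤ 10 ^ 34 * U ^ 56 * (256 * U ^ 8 / M + 10 ^ 36 * U ^ 64 / M) := by
            gcongr
            exact (abs_sub _ _).trans (add_le_add hw h2)
        _ = (256 * 10 ^ 34 * U ^ 64 + 10 ^ 70 * U ^ 120) / M := by ring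
        _ < 1 := by
          rw [div_lt_one hM0]
          have h5 : U ^ 64 ≤ U ^ 120 := pow_le_pow_right₀ hU (by norm_num)
          have h6 : 0 < U ^ 120 := by positivity
          linarith
    have h5 : (24 * (s.1.1 * s.1.2 * s.2) * b - w * r : ℤ) = 0 := by
      rw [← Int.abs_lt_one_iff]
      exact_mod_cast h4
    refine ⟨?_, ?_⟩
    · have h6 : (r : ℤ) ∣ 24 * (s.1.1 * s.1.2 * s.2) * b := ⟨w, by linarith⟩
      have h7 : IsCoprime (r : ℤ) b := by
        rw [Int.isCoprime_iff_gcd_eq_one, Int.gcd_comm]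
        simpa [Int.gcd] using ρ.reduced
      have h8 := h7.dvd_of_dvd_mul_right h6
      rwa [show ((24 : ℕ) : ℤ) * s.1.1 * s.1.2 * s.2 = 24 * (s.1.1 * s.1.2 * s.2) by
        push_cast; ring]
    · rw [h5] at h3
      have h9 : (s.1.1 * s.1.2 * s.2 * (24 * γ) - w) - 24 * (s.1.1 * s.1.2 * s.2 : ℝ) * β = 0 := by
        have := h3.symm
        push_cast at this
        exact (mul_eq_zero.1 this).resolve_left hr0'.ne'
      rw [← sub_eq_zero.1 h9]
      exact hw
  have hrM : r ≤ M := by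
    have := hpow 56 (by norm_num)
    have h2 : 0 < U ^ 56 := by positivity
    exact_mod_cast (show (r : ℝ) ≤ M by linarith)
  have hrfin : (r : ℝ) ≤ C₁ * U ^ 9 := by
    have h1 : (S.card : ℝ) ≤ 648 * (r.divisors.card : ℝ) ^ 3 * M ^ 3 / r := by
      have h2 := card_triples_dvd_le (c := 24) (by norm_num) hr0 hrM
      refine le_trans ?_ (h2.trans (by norm_num))
      refine Nat.cast_le.2 (Finset.card_le_card fun s hs => ?_)
      exact Finset.mem_filter.2 ⟨hS hs, (hkey s hs).1⟩
    have h2 : (r.divisors.card : ℝ) ^ 3 ≤ C₀ ^ 3 * (r : ℝ) ^ (1 / 10 : ℝ) := by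
      calc (r.divisors.card : ℝ) ^ 3 ≤ (C₀ * (r : ℝ) ^ (1 / 30 : ℝ)) ^ 3 := by
            gcongr
            exact hdiv r hr0.ne'
        _ = _ := by
          rw [mul_pow, ← Real.rpow_mul_natCast hr0'.le]
          norm_num
    have h3 : 1 / (32 * U ^ 8) * (M : ℝ) ^ 3 ≤
        648 * (C₀ ^ 3 * (r : ℝ) ^ (1 / 10 : ℝ)) * M ^ 3 / r := hcard.trans (h1.trans (by gcongr))
    have h4 : (r : ℝ) ^ (9 / 10 : ℝ) ≤ 32 * 648 * C₀ ^ 3 * U ^ 8 := by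
      have h5 : (r : ℝ) = (r : ℝ) ^ (9 / 10 : ℝ) * (r : ℝ) ^ (1 / 10 : ℝ) := by
        rw [← Real.rpow_add hr0']
        norm_num
      have h6 : (r : ℝ) * M ^ 3 ≤ 32 * 648 * C₀ ^ 3 * U ^ 8 * (r : ℝ) ^ (1 / 10 : ℝ) * M ^ 3 := by
        rw [div_mul_eq_mul_div, one_mul, div_le_div_iff₀ (by positivity) hr0'] at h3
        linarith
      have h7 := le_of_mul_le_mul_right h6 (by positivity)
      nth_rewrite 1 [h5] at h7
      exact le_of_mul_le_mul_right h7 (Real.rpow_pos_of_pos hr0' (1 / 10 : ℝ))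
    have h8 := Real.rpow_le_rpow (by positivity) h4 (show (0 : ℝ) ≤ 10 / 9 by norm_num)
    rw [← Real.rpow_mul hr0'.le, Real.mul_rpow (by positivity) (by positivity)] at h8
    rw [← hC₁, show (9 / 10 : ℝ) * (10 / 9) = 1 by norm_num, Real.rpow_one,
      ← Real.rpow_natCast_mul hU0.le] at h8
    refine h8.trans ?_
    gcongr
    rw [← Real.rpow_natCast]
    exact Real.rpow_le_rpow_of_exponent_le hU (by norm_num)
  obtain ⟨s, hs, hs1⟩ : ∃ s ∈ S, M / (3072 * U ^ 8) ≤ |(s.1.1 : ℝ)| ∧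
      M / (3072 * U ^ 8) ≤ |(s.1.2 : ℝ)| ∧ M / (3072 * U ^ 8) ≤ |(s.2 : ℝ)| := by
    by_contra! hcon
    have h1 := card_triples_some_abs_lt_le (M := M) (K := M / (3072 * U ^ 8)) (by positivity)
    have h2 : (S.card : ℝ) ≤ 12 * M ^ 2 * (2 * (M / (3072 * U ^ 8)) + 1) := by
      refine le_trans (Nat.cast_le.2 (Finset.card_le_card fun s hs => ?_)) h1
      refine Finset.mem_filter.2 ⟨hS hs, ?_⟩
      by_contra! h3
      exact absurd (hcon s hs h3.1 h3.2.1) (not_lt.2 h3.2.2)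
    have h3 := hcard.trans h2
    have h4 : 12 * (M : ℝ) ^ 2 * (2 * (M / (3072 * U ^ 8)) + 1) =
        M ^ 2 * (M / (128 * U ^ 8) + 12) := by field_simp; ring
    have h5 : 1 / (32 * U ^ 8) * (M : ℝ) ^ 3 = M ^ 2 * (4 * (M / (128 * U ^ 8))) := by
      field_simp; norm_num
    rw [h4, h5] at h3
    have h6 := le_of_mul_le_mul_left h3 (by positivity)
    have h7 : 100 ≤ M / (128 * U ^ 8) := by
      rw [le_div_iff₀ (by positivity)]
      have := hpow 8 (by norm_num)
      have : 0 < U ^ 8 := by positivity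
      nlinarith
    linarith
  refine ⟨r, b, hr0, ?_, ?_⟩
  · refine hrfin.trans ?_
    gcongr
    linarith
  have h1 := (hkey s hs).2
  have h2 : 24 * (M / (3072 * U ^ 8)) ^ 3 ≤ |24 * (s.1.1 * s.1.2 * s.2 : ℝ)| := by
    rw [abs_mul, abs_mul, abs_mul, abs_of_pos (show (0 : ℝ) < 24 by norm_num)]
    have hp : 0 ≤ M / (3072 * U ^ 8) := by positivity
    have := mul_le_mul (mul_le_mul hs1.1 hs1.2.1 hp (abs_nonneg _)) hs1.2.2 hp (by positivity)
    calc _ = 24 * (M / (3072 * U ^ 8) * (M / (3072 * U ^ 8)) * (M / (3072 * U ^ 8))) := by ring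
      _ ≤ _ := by linarith
  have h3 : 24 * (M / (3072 * U ^ 8)) ^ 3 * |β| ≤ 256 * U ^ 8 / M := by
    rw [abs_mul] at h1
    exact (mul_le_mul_of_nonneg_right h2 (abs_nonneg _)).trans h1
  have h4 : |β| ≤ 10 ^ 12 * U ^ 32 / M ^ 4 := by
    have h5 : 24 * (M / (3072 * U ^ 8)) ^ 3 = 24 * M ^ 3 / (3072 ^ 3 * U ^ 24) := by field_simp
    rw [h5, div_mul_eq_mul_div, div_le_div_iff₀ (by positivity) hM0] at h3
    rw [le_div_iff₀ (by positivity)]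
    have : 0 < U ^ 32 := by positivity
    linarith
  have h5 : r * γ - b = r * β := by
    rw [hβ]
    field_simp
  rw [h5, abs_mul, abs_of_pos hr0']
  calc (r : ℝ) * |β| ≤ (C₁ * U ^ 9) * (10 ^ 12 * U ^ 32 / M ^ 4) := by gcongr
    _ = 10 ^ 12 * (C₁ * U ^ 41) / M ^ 4 := by ring
    _ ≤ 10 ^ 80 * (C₁ * U ^ 41) / M ^ 4 := by
      have : (10 : ℝ) ^ 12 ≤ 10 ^ 80 := by norm_num
      gcongr
    _ = _ := by ring

theorem factorial_dvd_pow_mul_prod_arith (a d N : ℕ) :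
    N.factorial ∣ d ^ N * ∏ k ∈ Finset.range N, (a + d * k) := by
  rw [Nat.dvd_iff_prime_pow_dvd_dvd]
  intro p k hp hk
  by_cases hpd : p ∣ d
  · have h1 : k ≤ N := by
      have : Fact p.Prime := ⟨hp⟩
      have h2 : k ≤ padicValNat p N.factorial :=
        (padicValNat_dvd_iff_le (Nat.factorial_ne_zero N)).1 hk
      have h3 := sub_one_mul_padicValNat_factorial (p := p) N
      have h4 : 1 ≤ p - 1 := by have := hp.two_le; omega
      have h5 : padicValNat p N.factorial ≤ (p - 1) * padicValNat p N.factorial :=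
        Nat.le_mul_of_pos_left _ h4
      omega
    exact ((pow_dvd_pow p h1).trans (pow_dvd_pow_of_dvd hpd N)).mul_right _
  · refine Dvd.dvd.mul_left ?_ _
    have hcop : Nat.Coprime d (p ^ k) := ((hp.coprime_iff_not_dvd.2 hpd).symm).pow_right k
    have hcop' : IsUnit (d : ZMod (p ^ k)) := (ZMod.isUnit_iff_coprime d (p ^ k)).2 hcop
    obtain ⟨u, hu⟩ := hcop'
    have : NeZero (p ^ k) := ⟨(pow_pos hp.pos k).ne'⟩
    set m : ℕ := ((↑u⁻¹ : ZMod (p ^ k)) * a).val with hm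
    have h1 : (p ^ k) ∣ ∏ i ∈ Finset.range N, (m + i) := by
      refine hk.trans ?_
      rw [← Nat.ascFactorial_eq_prod_range]
      exact Nat.factorial_dvd_ascFactorial _ _
    rw [← ZMod.natCast_eq_zero_iff] at h1 ⊢
    push_cast at h1 ⊢
    have h2 : ∏ i ∈ Finset.range N, ((a : ZMod (p ^ k)) + d * i) =
        ∏ i ∈ Finset.range N, ((d : ZMod (p ^ k)) * (m + i)) := by
      refine Finset.prod_congr rfl fun i _ => ?_
      rw [hm, ZMod.natCast_val, ZMod.cast_id', id, mul_add, ← hu, ← mul_assoc, Units.mul_inv,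
        one_mul]
    rw [h2, Finset.prod_mul_distrib, h1, mul_zero]

theorem factorial_mul_prod_primes_le {a d N : ℕ} (ha : 0 < a) (hd : 0 < d) (s : Finset ℕ)
    (hs : ∀ p ∈ s, p.Prime ∧ N < p ∧ ¬ p ∣ d ∧ ∃ k < N, p = a + d * k) :
    N.factorial * ∏ p ∈ s, p ≤ d ^ N * ∏ k ∈ Finset.range N, (a + d * k) := by
  obtain ⟨w, hw⟩ := factorial_dvd_pow_mul_prod_arith a d N
  have hpos : 0 < d ^ N * ∏ k ∈ Finset.range N, (a + d * k) := by positivity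
  have h1 : ∏ p ∈ s, p ∣ w := by
    refine Finset.prod_primes_dvd w (fun p hp => (hs p hp).1.prime) fun p hp => ?_
    obtain ⟨h1, h2, h3, k, hk, hpk⟩ := hs p hp
    have h4 : p ∣ N.factorial * w := by
      rw [← hw]
      refine Dvd.dvd.mul_left ?_ _
      refine dvd_trans ?_ (Finset.dvd_prod_of_mem _ (Finset.mem_range.2 hk))
      rw [← hpk]
    refine (h1.dvd_mul.1 h4).resolve_left fun h5 => ?_
    exact absurd (h1.dvd_factorial.1 h5) (by omega)
  have hw0 : 0 < w := by
    rw [hw] at hpos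
    exact Nat.pos_of_mul_pos_left hpos
  rw [hw]
  exact Nat.mul_le_mul_left _ (Nat.le_of_dvd hw0 h1)

/-- A Brun–Titchmarsh type bound in arithmetic progressions. -/
theorem sum_log_primes_arith_le {Y d c : ℕ} (hY : 4 ≤ Y) (hd : 3 ≤ d) (s : Finset ℕ)
    (hs : ∀ p ∈ s, p.Prime ∧ Y ≤ p ∧ p < 2 * Y ∧ ¬ p ∣ d ∧ p % d = c) :
    ∑ p ∈ s, Real.log p ≤ 2 * (2 * Y / d + 1) * Real.log d := by
  have hd0 : (0 : ℝ) < d := by exact_mod_cast (show 0 < d by omega)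
  have hlogd : 0 ≤ Real.log d := Real.log_natCast_nonneg d
  rcases s.eq_empty_or_nonempty with rfl | ⟨p₀, hp₀⟩
  · simp only [Finset.sum_empty]
    positivity
  have hc : 0 < c := by
    obtain ⟨h1, h2, h3, h4, h5⟩ := hs p₀ hp₀
    by_contra h6
    have h7 : c = 0 := by omega
    rw [h7] at h5
    have h8 : d ∣ p₀ := Nat.dvd_of_mod_eq_zero h5
    rcases (Nat.dvd_prime h1).1 h8 with h9 | h9
    · omega
    · exact h4 (h9 ▸ dvd_rfl)
  have hcd : c < d := by
    rw [← (hs p₀ hp₀).2.2.2.2]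
    exact Nat.mod_lt _ (by omega)
  set N := 2 * Y / d + 1 with hN
  have hNY : N < Y := by
    have : 2 * Y / d ≤ 2 * Y / 3 := Nat.div_le_div_left hd (by norm_num)
    omega
  have h1 := factorial_mul_prod_primes_le (a := c) (d := d) (N := N) hc (by omega) s (by
    intro p hp
    obtain ⟨h1, h2, h3, h4, h5⟩ := hs p hp
    refine ⟨h1, by omega, h4, p / d, ?_, ?_⟩
    · have : p / d ≤ 2 * Y / d := Nat.div_le_div_right h3.le
      omega
    · rw [← h5, Nat.mod_add_div])
  have h2 : ∏ k ∈ Finset.range N, (c + d * k) ≤ d ^ N * N.factorial := by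
    rw [← Finset.prod_range_add_one_eq_factorial, ← Finset.card_range N, ← Finset.prod_const,
      Finset.card_range, ← Finset.prod_mul_distrib]
    refine Finset.prod_le_prod' fun k _ => ?_
    rw [mul_add, mul_one]
    omega
  have h3 : ∏ p ∈ s, p ≤ d ^ (2 * N) := by
    refine Nat.le_of_mul_le_mul_left (h1.trans ?_) (Nat.factorial_pos N)
    calc d ^ N * ∏ k ∈ Finset.range N, (c + d * k) ≤ d ^ N * (d ^ N * N.factorial) :=
          Nat.mul_le_mul_left _ h2
      _ = _ := by ring
  have h4 : ∑ p ∈ s, Real.log p = Real.log (∏ p ∈ s, p : ℕ) := by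
    rw [Nat.cast_prod, Real.log_prod]
    intro p hp
    exact_mod_cast (hs p hp).1.ne_zero
  have h5 : Real.log (∏ p ∈ s, p : ℕ) ≤ 2 * N * Real.log d := by
    have : Real.log ((d ^ (2 * N) : ℕ) : ℝ) = 2 * N * Real.log d := by
      push_cast
      rw [Real.log_pow]
      push_cast
      ring
    rw [← this]
    refine Real.log_le_log ?_ (by exact_mod_cast h3)
    exact_mod_cast Finset.prod_pos fun p hp => (hs p hp).1.pos
  rw [h4]
  refine h5.trans ?_
  have h6 : (N : ℝ) ≤ 2 * Y / d + 1 := by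
    rw [hN]
    push_cast
    gcongr
    refine Nat.cast_div_le.trans (le_of_eq ?_)
    push_cast
    ring
  gcongr

/-- A Brun–Titchmarsh type bound in short intervals. -/
theorem sum_log_primes_interval_le {x H : ℕ} (hH : 0 < H) (hx : H ≤ x) (s : Finset ℕ)
    (hs : ∀ p ∈ s, p.Prime ∧ x < p ∧ p ≤ x + H) :
    ∑ p ∈ s, Real.log p ≤ H * Real.log (Real.exp 1 * (x + H) / H) := by
  have hH0 : (0 : ℝ) < H := by exact_mod_cast hH
  have h1 := factorial_mul_prod_primes_le (a := x + 1) (d := 1) (N := H) (by omega) one_pos s (by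
    intro p hp
    obtain ⟨h1, h2, h3⟩ := hs p hp
    refine ⟨h1, by omega, fun h => h1.one_lt.ne' (Nat.dvd_one.1 h), p - (x + 1), by omega, by omega⟩)
  have h2 : ∏ k ∈ Finset.range H, (x + 1 + 1 * k) ≤ (x + H) ^ H := by
    refine (Finset.prod_le_pow_card _ _ (x + H) fun k hk => ?_).trans (by rw [Finset.card_range])
    have := Finset.mem_range.1 hk
    omega
  have h3 : (H.factorial : ℝ) * ∏ p ∈ s, (p : ℝ) ≤ (x + H) ^ H := by
    have h2' := h1.trans (by simpa using h2 : _ ≤ (x + H) ^ H)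
    have h3 := Nat.cast_le (α := ℝ) |>.2 h2'
    push_cast at h3
    exact h3
  have h4 : (H : ℝ) ^ H ≤ Real.exp 1 ^ H * H.factorial := by
    have := Real.pow_div_factorial_le_exp (x := (H : ℝ)) hH0.le H
    rw [div_le_iff₀ (by positivity)] at this
    rwa [← Real.exp_nat_mul, mul_one]
  have hpos : 0 < ∏ p ∈ s, (p : ℝ) := Finset.prod_pos fun p hp => by
    exact_mod_cast (hs p hp).1.pos
  have h5 : ∏ p ∈ s, (p : ℝ) ≤ (Real.exp 1 * (x + H) / H) ^ H := by
    rw [div_pow, mul_pow, le_div_iff₀ (by positivity)]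
    calc (∏ p ∈ s, (p : ℝ)) * H ^ H ≤ (∏ p ∈ s, (p : ℝ)) * (Real.exp 1 ^ H * H.factorial) := by
          gcongr
      _ = Real.exp 1 ^ H * (H.factorial * ∏ p ∈ s, (p : ℝ)) := by ring
      _ ≤ _ := by gcongr
  rw [← Real.log_prod (fun p hp => by exact_mod_cast (hs p hp).1.ne_zero), ← Real.log_pow]
  exact Real.log_le_log hpos h5

theorem sum_log_primes_fourth_power_congr_le {Y d l : ℕ} (hY : 4 ≤ Y) (hd : 3 ≤ d)
    (hl : l.Prime) (s : Finset ℕ)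
    (hs : ∀ p ∈ s, p.Prime ∧ Y ≤ p ∧ p < 2 * Y ∧ p ≠ l ∧ (d : ℤ) ∣ (p : ℤ) ^ 4 - (l : ℤ) ^ 4) :
    ∑ p ∈ s, Real.log p ≤ fourthRootCount d * (2 * (2 * Y / d + 1) * Real.log d) := by
  classical
  have hlogd : 0 ≤ Real.log d := Real.log_natCast_nonneg d
  have : NeZero d := ⟨by omega⟩
  rcases s.eq_empty_or_nonempty with rfl | ⟨p₀, hp₀⟩
  · simp only [Finset.sum_empty]
    positivity
  have hnd : ∀ a b : ℕ, a.Prime → b.Prime → a ≠ b → (d : ℤ) ∣ (a : ℤ) ^ 4 - (b : ℤ) ^ 4 →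
      ¬ a ∣ d := by
    intro a b ha hb hab h1 h2
    have h3 : (a : ℤ) ∣ (a : ℤ) ^ 4 - (b : ℤ) ^ 4 := (Int.natCast_dvd_natCast.2 h2).trans h1
    have h4 : (a : ℤ) ∣ (b : ℤ) ^ 4 := (dvd_sub_right (dvd_pow_self _ (by norm_num))).1 h3
    have h5 : a ∣ b ^ 4 := by exact_mod_cast h4
    exact hab ((Nat.prime_dvd_prime_iff_eq ha hb).1 (ha.dvd_of_dvd_pow h5))
  have hld : Nat.Coprime l d := by
    obtain ⟨h1, -, -, h2, h3⟩ := hs p₀ hp₀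
    exact (hl.coprime_iff_not_dvd).2 (hnd l p₀ hl h1 h2.symm ((dvd_sub_comm).1 h3))
  obtain ⟨u, hu⟩ := (ZMod.isUnit_iff_coprime l d).2 hld
  have hcard : (s.image (· % d)).card ≤ fourthRootCount d := by
    have hroot : ∀ c ∈ s.image (· % d), ((c : ZMod d) * ↑u⁻¹) ^ 4 = 1 := by
      intro c hc
      obtain ⟨p, hp, rfl⟩ := Finset.mem_image.1 hc
      have h1 := (ZMod.intCast_zmod_eq_zero_iff_dvd _ d).2 (hs p hp).2.2.2.2
      push_cast at h1
      rw [ZMod.natCast_mod, mul_pow, sub_eq_zero.1 h1, ← hu, ← mul_pow, Units.mul_inv, one_pow]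
    have h2 : Nat.card (s.image (· % d)) ≤ fourthRootCount d := by
      refine Nat.card_le_card_of_injective
        (fun c : s.image (· % d) => ⟨(c.1 : ZMod d) * ↑u⁻¹, hroot c.1 c.2⟩) ?_
      rintro ⟨c, hc⟩ ⟨c', hc'⟩ h
      simp only [Subtype.mk.injEq] at h ⊢
      have h3 := (Units.mul_left_inj u⁻¹).1 h
      obtain ⟨p, -, rfl⟩ := Finset.mem_image.1 hc
      obtain ⟨p', -, rfl⟩ := Finset.mem_image.1 hc'
      rw [ZMod.natCast_eq_natCast_iff'] at h3
      simpa using h3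
    rwa [Nat.card_eq_fintype_card, Fintype.card_coe] at h2
  have hfib : ∀ c ∈ s.image (· % d), ∑ p ∈ s with p % d = c, Real.log p ≤
      2 * (2 * Y / d + 1) * Real.log d := by
    intro c _
    refine sum_log_primes_arith_le (c := c) hY hd _ fun p hp => ?_
    obtain ⟨hp1, hp2⟩ := Finset.mem_filter.1 hp
    obtain ⟨h1, h2, h3, h4, h5⟩ := hs p hp1
    exact ⟨h1, h2, h3, hnd p l h1 hl h4 h5, hp2⟩
  rw [← Finset.sum_fiberwise_of_maps_to (g := (· % d)) (t := s.image (· % d))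
    (fun p hp => Finset.mem_image_of_mem _ hp)]
  refine (Finset.sum_le_card_nsmul _ _ _ hfib).trans ?_
  rw [nsmul_eq_mul]
  gcongr

theorem exists_far_prime {Y l : ℕ} {κ : ℝ} (hκ : 0 < κ) (hκ1 : κ ≤ 1) (hY : 200 ≤ κ ^ 2 * Y)
    (hl : Y ≤ l) (hl2 : l < 2 * Y) (G : Finset ℕ) (hG : ∀ p ∈ G, p.Prime)
    (hsum : κ * Y ≤ ∑ p ∈ G, Real.log p) :
    ∃ p ∈ G, κ ^ 2 * Y / 100 ≤ |(p : ℝ) - l| := by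
  by_contra! hcon
  set K : ℕ := ⌊κ ^ 2 * Y / 100⌋₊ with hK
  have hκY : κ ^ 2 * Y ≤ Y := by
    have : κ ^ 2 ≤ 1 := pow_le_one₀ hκ.le hκ1
    nlinarith [(Nat.cast_nonneg Y : (0 : ℝ) ≤ Y)]
  have hK1 : (K : ℝ) ≤ κ ^ 2 * Y / 100 := Nat.floor_le (by positivity)
  have hY0 : (0 : ℝ) < Y := by linarith
  have hKY : 3 * K + 2 ≤ Y := by
    have : (3 * K + 2 : ℝ) ≤ Y := by linarith
    exact_mod_cast this
  have h1 := sum_log_primes_interval_le (x := l - K - 1) (H := 2 * K + 1) (by omega) (by omega) G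
    (by
      intro p hp
      have h2 := hcon p hp
      have h3 : ((|(p : ℤ) - l| : ℤ) : ℝ) ≤ κ ^ 2 * Y / 100 := by
        push_cast
        exact h2.le
      have h4 : |(p : ℤ) - l| ≤ K := by
        rw [hK, ← Int.natCast_natAbs, Nat.cast_le]
        refine Nat.le_floor ?_
        rw [Nat.cast_natAbs]
        exact h3
      rw [abs_le] at h4
      exact ⟨hG p hp, by omega, by omega⟩)
  have hH0 : (0 : ℝ) < ((2 * K + 1 : ℕ) : ℝ) := by positivity
  have hH : ((2 * K + 1 : ℕ) : ℝ) ≤ κ ^ 2 * Y / 40 := by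
    push_cast
    linarith
  set H : ℝ := ((2 * K + 1 : ℕ) : ℝ) with hHdef
  have h2 : (((l - K - 1 : ℕ) : ℝ) + H) ≤ 3 * Y := by
    rw [hHdef]
    exact_mod_cast (show l - K - 1 + (2 * K + 1) ≤ 3 * Y by omega)
  have h3 : Real.exp 1 * (((l - K - 1 : ℕ) : ℝ) + H) / H ≤ 9 * Y / H := by
    have := Real.exp_one_lt_three
    have h4 : 0 ≤ (((l - K - 1 : ℕ) : ℝ) + H) := by positivity
    refine div_le_div_of_nonneg_right ?_ hH0.le
    nlinarith
  have h4 : Real.log (Real.exp 1 * (((l - K - 1 : ℕ) : ℝ) + H) / H) ≤ 2 * √(9 * Y / H) := by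
    refine (Real.log_le_log (by positivity) h3).trans ?_
    have h5 := Real.log_le_self (Real.sqrt_nonneg (9 * Y / H))
    rw [Real.log_sqrt (by positivity)] at h5
    linarith
  have h5 : κ * Y ≤ 2 * (H * √(9 * Y / H)) := by
    calc κ * Y ≤ H * Real.log (Real.exp 1 * (((l - K - 1 : ℕ) : ℝ) + H) / H) := hsum.trans h1
      _ ≤ H * (2 * √(9 * Y / H)) := by gcongr
      _ = _ := by ring
  have h6 : (κ * Y) ^ 2 ≤ (2 * (H * √(9 * Y / H))) ^ 2 := by gcongr
  have h7 : (2 * (H * √(9 * Y / H))) ^ 2 = 36 * H * Y := by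
    rw [mul_pow, mul_pow, Real.sq_sqrt (by positivity)]
    field_simp
    norm_num
  rw [h7] at h6
  have h8 : 36 * H * Y ≤ 36 * (κ ^ 2 * Y / 40) * Y := by gcongr
  have : 0 < κ ^ 2 * Y * Y := by positivity
  nlinarith

/-- The modulus bound behind `exists_rational_approx_of_many_primes`. -/
theorem exists_modulus_le_of_many_primes :
    ∃ C : ℝ, 1 ≤ C ∧ ∀ (Y l q : ℕ) (A κ : ℝ) (G : Finset ℕ), 1 ≤ A → 0 < κ → κ ≤ 1 →
      C * (A / κ) ^ 2 ≤ Y → 1 ≤ q → q ≤ 16 * A * Y ^ 4 → l.Prime →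
      (∀ p ∈ G, p.Prime ∧ Y ≤ p ∧ p < 2 * Y ∧ p ≠ l) →
      κ * Y ≤ ∑ p ∈ G, Real.log p →
      (∀ p ∈ G, ∃ r : ℕ, 1 ≤ r ∧ r ≤ A ∧ (q : ℤ) ∣ r * ((p : ℤ) ^ 4 - (l : ℤ) ^ 4)) →
      q ≤ C * (A / κ) ^ 2 := by
  obtain ⟨C₁, hC₁, hdiv⟩ := exists_card_divisors_le_rpow (show (0 : ℝ) < 1 / 60 by norm_num)
  obtain ⟨C₂, hC₂, hroot⟩ := exists_fourthRootCount_le_rpow (show (0 : ℝ) < 1 / 60 by norm_num)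
  set C₃ : ℝ := 120 * C₁ * C₂ with hC₃
  have hC₃1 : 120 ≤ C₃ := by nlinarith
  refine ⟨16 * C₃ ^ 2, by nlinarith, ?_⟩
  intro Y l q A κ G hA hκ hκ1 hY hq1 hqY hl hG hsum hr
  have hAκ : 1 ≤ A / κ := by rw [one_le_div hκ]; linarith
  have hAκ' : A ≤ A / κ := le_div_self (by linarith) hκ hκ1
  have hAκ2 : A / κ ≤ (A / κ) ^ 2 := le_self_pow₀ hAκ (by norm_num)
  have hbig : 3 * (A / κ) ^ 2 ≤ 16 * C₃ ^ 2 * (A / κ) ^ 2 := by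
    gcongr
    nlinarith
  have hq0 : (0 : ℝ) < q := by exact_mod_cast hq1
  have hq1' : (1 : ℝ) ≤ q := by exact_mod_cast hq1
  rcases lt_or_ge (q : ℝ) (3 * A) with hqA | hqA
  · linarith
  have hYbig : 16 * C₃ ^ 2 ≤ (Y : ℝ) := by
    refine le_trans ?_ hY
    nlinarith [one_le_pow₀ hAκ (n := 2)]
  have hY16 : (16 : ℝ) ≤ Y := by nlinarith
  have hY0 : (0 : ℝ) < Y := by linarith
  have hY4 : 4 ≤ Y := by
    have : (4 : ℝ) ≤ Y := by linarith
    exact_mod_cast this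
  choose! r hr1 hrA hrdvd using hr
  set X : ℝ := (q : ℝ) ^ (1 / 20 : ℝ) with hX
  have hX0 : 0 < X := Real.rpow_pos_of_pos hq0 _
  have hclass : ∀ g ∈ q.divisors, ∑ p ∈ G with q.gcd (r p) = g, Real.log p ≤
      C₂ * (q : ℝ) ^ (1 / 60 : ℝ) * (2 * (2 * Y * A / q + 1) * (60 * (q : ℝ) ^ (1 / 60 : ℝ))) := by
    intro g hg
    have hgq := Nat.dvd_of_mem_divisors hg
    rcases (G.filter (fun p => q.gcd (r p) = g)).eq_empty_or_nonempty with hem | ⟨p₀, hp₀⟩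
    · rw [hem, Finset.sum_empty]
      positivity
    obtain ⟨hp₀G, hp₀g⟩ := Finset.mem_filter.1 hp₀
    have hg0 : 0 < g := Nat.pos_of_dvd_of_pos hgq hq1
    have hgA : (g : ℝ) ≤ A := by
      refine le_trans ?_ (hrA p₀ hp₀G)
      have : g ≤ r p₀ := by
        rw [← hp₀g]
        exact Nat.le_of_dvd (hr1 p₀ hp₀G) (Nat.gcd_dvd_right _ _)
      exact_mod_cast this
    obtain ⟨d, hd⟩ := hgq
    have hqgd : (q : ℝ) = g * d := by exact_mod_cast hd
    have hd0 : 0 < d := Nat.pos_of_ne_zero fun h => by rw [h] at hd; omega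
    have hd0' : (0 : ℝ) < d := by exact_mod_cast hd0
    have hg0' : (0 : ℝ) < g := by exact_mod_cast hg0
    have hqd : (q : ℝ) ≤ A * d := by rw [hqgd]; gcongr
    have hd3 : 3 ≤ d := by
      have : (3 : ℝ) ≤ d := by
        by_contra! h
        nlinarith
      exact_mod_cast this
    have hdq : (d : ℝ) ≤ q := by
      rw [hqgd]
      have : (1 : ℝ) ≤ g := by exact_mod_cast hg0
      nlinarith
    have h1 := sum_log_primes_fourth_power_congr_le hY4 hd3 hl
      (G.filter (fun p => q.gcd (r p) = g)) (by
        intro p hp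
        obtain ⟨hpG, hpg⟩ := Finset.mem_filter.1 hp
        obtain ⟨f1, f2, f3, f4⟩ := hG p hpG
        refine ⟨f1, f2, f3, f4, ?_⟩
        have f5 := hrdvd p hpG
        obtain ⟨r', hr'⟩ : g ∣ r p := hpg ▸ Nat.gcd_dvd_right _ _
        have hcop : Nat.Coprime d r' := by
          have := hpg
          rw [hd, hr', Nat.gcd_mul_left] at this
          exact Nat.eq_of_mul_eq_mul_left hg0 (by rw [this, mul_one])
        rw [hd, hr'] at f5
        push_cast at f5
        rw [mul_assoc] at f5
        have f6 := Int.dvd_of_mul_dvd_mul_left (by exact_mod_cast hg0.ne') f5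
        exact (Int.isCoprime_iff_gcd_eq_one.2 (by simpa using hcop)).dvd_of_dvd_mul_left f6)
    refine h1.trans ?_
    have h2 : (fourthRootCount d : ℝ) ≤ C₂ * (q : ℝ) ^ (1 / 60 : ℝ) :=
      (hroot d hd0.ne').trans (by gcongr)
    have h3 : Real.log d ≤ 60 * (q : ℝ) ^ (1 / 60 : ℝ) := by
      have := Real.log_le_rpow_div hd0'.le (show (0 : ℝ) < 1 / 60 by norm_num)
      calc Real.log d ≤ 60 * (d : ℝ) ^ (1 / 60 : ℝ) := by linarith
        _ ≤ _ := by gcongr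
    have h4 : 2 * Y / d ≤ 2 * Y * A / (q : ℝ) := by
      rw [div_le_div_iff₀ hd0' hq0]
      nlinarith
    have h5 : 0 ≤ Real.log d := Real.log_natCast_nonneg d
    gcongr
  have htotal : κ * Y ≤ C₃ * X * (2 * Y * A / q + 1) := by
    rw [← Finset.sum_fiberwise_of_maps_to (g := fun p => q.gcd (r p)) (t := q.divisors)
      (fun p _ => Nat.mem_divisors.2 ⟨Nat.gcd_dvd_left _ _, by omega⟩)] at hsum
    refine hsum.trans ((Finset.sum_le_card_nsmul _ _ _ hclass).trans ?_)
    rw [nsmul_eq_mul]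
    have h1 : X = (q : ℝ) ^ (1 / 60 : ℝ) * (q : ℝ) ^ (1 / 60 : ℝ) * (q : ℝ) ^ (1 / 60 : ℝ) := by
      rw [← Real.rpow_add hq0, ← Real.rpow_add hq0, hX]
      norm_num
    calc _ ≤ C₁ * (q : ℝ) ^ (1 / 60 : ℝ) * (C₂ * (q : ℝ) ^ (1 / 60 : ℝ) *
          (2 * (2 * Y * A / q + 1) * (60 * (q : ℝ) ^ (1 / 60 : ℝ)))) := by
          gcongr
          exact hdiv q (by omega)
      _ = _ := by rw [h1, hC₃]; ring
  have hXY : C₃ * X ≤ κ * Y / 2 := by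
    have hAY : A ≤ Y := by linarith
    have h1 : X ≤ √Y := by
      rw [hX, Real.sqrt_eq_rpow]
      have h2 : (q : ℝ) ≤ (Y : ℝ) ^ (6 : ℝ) := by
        rw [show (6 : ℝ) = ((6 : ℕ) : ℝ) by norm_num, Real.rpow_natCast]
        calc (q : ℝ) ≤ 16 * A * Y ^ 4 := hqY
          _ ≤ Y * Y * Y ^ 4 := by gcongr
          _ = _ := by ring
      calc (q : ℝ) ^ (1 / 20 : ℝ) ≤ ((Y : ℝ) ^ (6 : ℝ)) ^ (1 / 20 : ℝ) := by gcongr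
        _ = (Y : ℝ) ^ (6 / 20 : ℝ) := by rw [← Real.rpow_mul hY0.le]; norm_num
        _ ≤ _ := Real.rpow_le_rpow_of_exponent_le (by linarith) (by norm_num)
    have h2 : 4 * C₃ ≤ κ * √Y := by
      have h3 : (4 * C₃ * (A / κ)) ≤ √Y := by
        refine Real.le_sqrt_of_sq_le ?_
        refine le_trans (le_of_eq ?_) hY
        ring
      calc 4 * C₃ ≤ 4 * C₃ * A := by nlinarith
        _ = κ * (4 * C₃ * (A / κ)) := by field_simp
        _ ≤ _ := by gcongr
    have h3 : √(Y : ℝ) * √Y = Y := Real.mul_self_sqrt hY0.le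
    have h4 : 0 ≤ √(Y : ℝ) := Real.sqrt_nonneg _
    calc C₃ * X ≤ C₃ * √Y := by gcongr
      _ ≤ (κ * √Y / 4) * √Y := by gcongr; linarith
      _ = κ * (√(Y : ℝ) * √Y) / 4 := by ring
      _ ≤ κ * Y / 2 := by rw [h3]; nlinarith
  have h1 : κ * Y ≤ 4 * (C₃ * X * (Y * A / q)) := by
    have : C₃ * X * (2 * Y * A / q + 1) = 2 * (C₃ * X * (Y * A / q)) + C₃ * X := by ring
    linarith
  have h2 : (q : ℝ) ≤ 4 * C₃ * (A / κ) * X := by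
    rw [show 4 * (C₃ * X * (Y * A / q)) = Y * (4 * C₃ * X * A) / q by ring,
      le_div_iff₀ hq0] at h1
    have h3 : (Y : ℝ) * (κ * q) ≤ Y * (4 * C₃ * X * A) := by linarith
    have h4 := le_of_mul_le_mul_left h3 hY0
    rw [show 4 * C₃ * (A / κ) * X = 4 * C₃ * X * A / κ by ring, le_div_iff₀ hκ]
    linarith
  have h3 : X ≤ √q := by
    rw [hX, Real.sqrt_eq_rpow]
    exact Real.rpow_le_rpow_of_exponent_le hq1' (by norm_num)
  have h4 : √(q : ℝ) * √q = q := Real.mul_self_sqrt hq0.le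
  have h5 : √(q : ℝ) ≤ 4 * C₃ * (A / κ) := by
    refine le_of_mul_le_mul_right ?_ (Real.sqrt_pos.2 hq0)
    rw [h4]
    exact h2.trans (by gcongr)
  calc (q : ℝ) = √(q : ℝ) ^ 2 := (Real.sq_sqrt hq0.le).symm
    _ ≤ (4 * C₃ * (A / κ)) ^ 2 := by gcongr
    _ = _ := by ring

theorem exists_rational_approx_of_many_primes :
    ∃ C : ℝ, 1 ≤ C ∧ ∀ (Y l : ℕ) (A κ δ α : ℝ) (G : Finset ℕ), 1 ≤ A → 0 < κ → κ ≤ 1 →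
      C * (A / κ) ^ 2 ≤ Y → 0 ≤ δ → 32 * A * Y ^ 4 * δ < 1 → l.Prime → Y ≤ l → l < 2 * Y →
      (∀ p ∈ G, p.Prime ∧ Y ≤ p ∧ p < 2 * Y ∧ p ≠ l) →
      κ * Y ≤ ∑ p ∈ G, Real.log p →
      (∀ p ∈ G, ∃ (r : ℕ) (b : ℤ), 1 ≤ r ∧ r ≤ A ∧
        |r * (α * ((p : ℝ) ^ 4 - (l : ℝ) ^ 4)) - b| ≤ δ) →
      ∃ (q : ℕ) (a : ℤ), 1 ≤ q ∧ q ≤ C * (A / κ) ^ 2 ∧ |α - a / q| ≤ C * δ / (κ ^ 2 * Y ^ 4) := by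
  obtain ⟨C₀, hC₀, hmod⟩ := exists_modulus_le_of_many_primes
  refine ⟨200 * C₀, by linarith, ?_⟩
  intro Y l A κ δ α G hA hκ hκ1 hY hδ hδ1 hl hlY hlY2 hG hsum hr
  have hAκ : 1 ≤ A / κ := by rw [one_le_div hκ]; linarith
  have hY' : C₀ * (A / κ) ^ 2 ≤ Y := by
    refine le_trans ?_ hY
    have : 0 ≤ C₀ * (A / κ) ^ 2 := by positivity
    linarith
  have hκY : 200 ≤ κ ^ 2 * Y := by
    have h1 : 200 * (1 / κ) ^ 2 ≤ (Y : ℝ) := by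
      refine le_trans ?_ hY
      gcongr
      linarith
    calc 200 = κ ^ 2 * (200 * (1 / κ) ^ 2) := by field_simp
      _ ≤ _ := by gcongr
  have hY0 : (0 : ℝ) < Y := by
    refine lt_of_lt_of_le ?_ hY
    positivity
  choose! r b hr1 hrA hrb using hr
  -- the integers `n p = r p * (p ^ 4 - l ^ 4)`
  set n : ℕ → ℤ := fun p => r p * ((p : ℤ) ^ 4 - (l : ℤ) ^ 4) with hn
  have hnα : ∀ p ∈ G, |n p * α - b p| ≤ δ := by
    intro p hp
    refine le_trans (le_of_eq ?_) (hrb p hp)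
    rw [hn]
    push_cast
    ring_nf
  have hn0 : ∀ p ∈ G, n p ≠ 0 := by
    intro p hp
    refine mul_ne_zero (by have := hr1 p hp; positivity) fun h => (hG p hp).2.2.2 ?_
    have h1 : p ^ 4 = l ^ 4 := by exact_mod_cast sub_eq_zero.1 h
    exact Nat.pow_left_injective (n := 4) (by norm_num) h1
  have hnA : ∀ p ∈ G, |(n p : ℝ)| ≤ 16 * A * Y ^ 4 := by
    intro p hp
    have h1 : (p : ℝ) ≤ 2 * Y := by exact_mod_cast (hG p hp).2.2.1.le
    have h2 : (l : ℝ) ≤ 2 * Y := by exact_mod_cast hlY2.le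
    have h3 : |(p : ℝ) ^ 4 - (l : ℝ) ^ 4| ≤ (2 * Y) ^ 4 := by
      refine abs_sub_le_of_nonneg_of_le (by positivity) (by gcongr) (by positivity) (by gcongr)
    rw [hn]
    push_cast
    rw [abs_mul, Nat.abs_cast]
    calc _ ≤ A * (2 * (Y : ℝ)) ^ 4 := mul_le_mul (hrA p hp) h3 (abs_nonneg _) (by linarith)
      _ = _ := by ring
  obtain ⟨p₀, hp₀⟩ : G.Nonempty := by
    rw [Finset.nonempty_iff_ne_empty]
    rintro rfl
    rw [Finset.sum_empty] at hsum
    have : 0 < κ * Y := by positivity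
    linarith
  set ρ : ℚ := (b p₀ : ℚ) / n p₀ with hρ
  set q := ρ.den with hq
  set a := ρ.num with ha
  have hq1 : 1 ≤ q := ρ.den_pos
  have hq0 : (0 : ℝ) < q := by exact_mod_cast hq1
  have hqn : (q : ℝ) ≤ |(n p₀ : ℝ)| := by
    have h1 : (q : ℤ) ∣ n p₀ := by
      have := Rat.den_dvd (b p₀) (n p₀)
      rwa [Rat.divInt_eq_div] at this
    have h2 : (q : ℤ) ∣ |n p₀| := (dvd_abs _ _).2 h1
    have h3 := Int.le_of_dvd (abs_pos.2 (hn0 p₀ hp₀)) h2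
    exact_mod_cast h3
  have hρq : (a : ℝ) / q = b p₀ / n p₀ := by
    have h1 : ((ρ : ℚ) : ℝ) = (a : ℝ) / q := by rw [ha, hq, Rat.cast_def]
    rw [← h1, hρ]
    push_cast
    rfl
  have hn0' : ∀ p ∈ G, (n p : ℝ) ≠ 0 := fun p hp => by exact_mod_cast hn0 p hp
  set β : ℝ := α - a / q with hβ
  have hβ0 : |(n p₀ : ℝ)| * |β| ≤ δ := by
    rw [← abs_mul, hβ, hρq, mul_sub, mul_div_cancel₀ _ (hn0' p₀ hp₀)]
    exact hnα p₀ hp₀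
  have hkey : ∀ p ∈ G, (q : ℤ) ∣ n p ∧ |(n p : ℝ)| * |β| ≤ δ := by
    intro p hp
    have h1 : ((n p * a - b p * q : ℤ) : ℝ) = q * ((n p * α - b p) - n p * β) := by
      rw [hβ]
      push_cast
      field_simp
      ring
    have h2 : |((n p * a - b p * q : ℤ) : ℝ)| < 1 := by
      rw [h1, abs_mul, abs_of_pos hq0]
      calc (q : ℝ) * |(n p * α - b p) - n p * β| ≤ q * (δ + |(n p : ℝ)| * |β|) := by
            gcongr
            refine (abs_sub _ _).trans (add_le_add (hnα p hp) ?_)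
            rw [abs_mul]
        _ = q * δ + |(n p : ℝ)| * (q * |β|) := by ring
        _ ≤ 16 * A * Y ^ 4 * δ + 16 * A * Y ^ 4 * (|(n p₀ : ℝ)| * |β|) := by
          gcongr
          · exact hqn.trans (hnA p₀ hp₀)
          · exact hnA p hp
        _ ≤ 16 * A * Y ^ 4 * δ + 16 * A * Y ^ 4 * δ := by gcongr
        _ < 1 := by linarith
    have h3 : (n p * a - b p * q : ℤ) = 0 := by
      rw [← Int.abs_lt_one_iff]
      exact_mod_cast h2
    refine ⟨?_, ?_⟩
    · have h4 : (q : ℤ) ∣ n p * a := ⟨b p, by linarith⟩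
      have h5 : IsCoprime (q : ℤ) a := by
        rw [Int.isCoprime_iff_gcd_eq_one, Int.gcd_comm]
        simpa [Int.gcd] using ρ.reduced
      exact h5.dvd_of_dvd_mul_right h4
    · rw [h3] at h1
      have h4 : (n p * α - b p) - n p * β = 0 := by
        have := h1.symm
        push_cast at this
        exact (mul_eq_zero.1 this).resolve_left hq0.ne'
      rw [← abs_mul, ← sub_eq_zero.1 h4]
      exact hnα p hp
  refine ⟨q, a, hq1, ?_, ?_⟩
  · refine (hmod Y l q A κ G hA hκ hκ1 hY' hq1 (hqn.trans (hnA p₀ hp₀)) hl hG hsum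
      fun p hp => ⟨r p, hr1 p hp, hrA p hp, (hkey p hp).1⟩).trans ?_
    gcongr
    linarith
  · obtain ⟨p, hp, hpl⟩ := exists_far_prime hκ hκ1 hκY hlY hlY2 G (fun p hp => (hG p hp).1) hsum
    have h1 := (hkey p hp).2
    have hpY : (Y : ℝ) ≤ p := by exact_mod_cast (hG p hp).2.1
    have hlY' : (Y : ℝ) ≤ l := by exact_mod_cast hlY
    have h2 : κ ^ 2 * Y ^ 4 / 100 ≤ |(n p : ℝ)| := by
      rw [hn]
      push_cast
      rw [show (r p : ℝ) * ((p : ℝ) ^ 4 - (l : ℝ) ^ 4) =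
        (r p * ((p + l) * (p ^ 2 + l ^ 2))) * (p - l) by ring, abs_mul,
        abs_of_nonneg (by positivity)]
      have h3 : (1 : ℝ) ≤ r p := by exact_mod_cast hr1 p hp
      calc κ ^ 2 * Y ^ 4 / 100 = (1 * ((Y + 0) * (Y ^ 2 + 0))) * (κ ^ 2 * Y / 100) := by ring
        _ ≤ _ := by gcongr <;> positivity
    rw [le_div_iff₀ (by positivity)]
    have h3 : κ ^ 2 * Y ^ 4 / 100 * |β| ≤ δ :=
      (mul_le_mul_of_nonneg_right h2 (abs_nonneg _)).trans h1
    nlinarith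

theorem norm_sq_bilinear_le (α : ℝ) {Y N : ℕ} (hY : 0 < Y) (s : Finset ℕ) (hs : ∀ p ∈ s, Y ≤ p)
    (w : ℕ → ℝ) (hw : ∀ p ∈ s, 0 ≤ w p) (A : Set ℕ) [DecidablePred (· ∈ A)] :
    ‖∑ p ∈ s, (w p : ℂ) * ∑ m ∈ Finset.Icc 1 (N / Y) with m ∈ A ∧ p * m ≤ N,
        e (α * ((p * m : ℕ) : ℝ) ^ 4)‖ ^ 2 ≤
      (N / Y : ℕ) * ∑ p ∈ s, ∑ l ∈ s, w l * (w p *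
        ‖∑ x ∈ Finset.Icc (1 : ℤ) ((N / max p l : ℕ) : ℤ),
          e (α * ((p : ℝ) ^ 4 - (l : ℝ) ^ 4) * x ^ 4)‖) := by
  set I := Finset.Icc 1 (N / Y) with hI
  set t : ℕ → ℕ → ℂ := fun p m => if p * m ≤ N then (w p : ℂ) * e (α * ((p * m : ℕ) : ℝ) ^ 4) else 0
    with ht
  have h1 : ∑ p ∈ s, (w p : ℂ) * ∑ m ∈ I with m ∈ A ∧ p * m ≤ N,
      e (α * ((p * m : ℕ) : ℝ) ^ 4) = ∑ m ∈ I with m ∈ A, ∑ p ∈ s, t p m := by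
    rw [Finset.sum_comm]
    refine Finset.sum_congr rfl fun p _ => ?_
    rw [Finset.mul_sum, ← Finset.filter_filter, Finset.sum_filter]
  have h2 : ∀ m, (‖∑ p ∈ s, t p m‖ : ℂ) ^ 2 = ∑ p ∈ s, ∑ l ∈ s, t p m * (starRingEnd ℂ) (t l m) := by
    intro m
    rw [← Complex.mul_conj', map_sum, Finset.sum_mul_sum]
  have h3 : ((∑ m ∈ I, ‖∑ p ∈ s, t p m‖ ^ 2 : ℝ) : ℂ) =
      ∑ p ∈ s, ∑ l ∈ s, ((w l : ℂ) * (w p * ∑ x ∈ Finset.Icc (1 : ℤ) ((N / max p l : ℕ) : ℤ),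
          e (α * ((p : ℝ) ^ 4 - (l : ℝ) ^ 4) * x ^ 4))) := by
    simp only [Complex.ofReal_sum, Complex.ofReal_pow, h2]
    rw [Finset.sum_comm]
    refine Finset.sum_congr rfl fun p hp => ?_
    rw [Finset.sum_comm]
    refine Finset.sum_congr rfl fun l hl => ?_
    have h4 : ∀ m ∈ I, t p m * (starRingEnd ℂ) (t l m) = if max p l * m ≤ N then
        (w l : ℂ) * (w p * e (α * ((p : ℝ) ^ 4 - (l : ℝ) ^ 4) * ((m : ℤ) : ℝ) ^ 4)) else 0 := by
      intro m _
      have hmax : max p l * m ≤ N ↔ p * m ≤ N ∧ l * m ≤ N := by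
        rw [max_mul_of_nonneg _ _ (Nat.zero_le m), max_le_iff]
      simp only [ht, hmax]
      by_cases hp1 : p * m ≤ N
      · by_cases hl1 : l * m ≤ N
        · simp only [hp1, hl1, and_self, if_true, map_mul, Complex.conj_ofReal, conj_e]
          rw [show α * ((p : ℝ) ^ 4 - (l : ℝ) ^ 4) * ((m : ℤ) : ℝ) ^ 4 =
            α * ((p * m : ℕ) : ℝ) ^ 4 + -(α * ((l * m : ℕ) : ℝ) ^ 4) by push_cast; ring, e_add]
          ring
        · simp [hl1]
      · simp [hp1]
    rw [Finset.sum_congr rfl h4, ← Finset.sum_filter, ← Finset.mul_sum, ← Finset.mul_sum]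
    congr 2
    have hmax0 : 0 < max p l := lt_of_lt_of_le hY ((hs p hp).trans (le_max_left _ _))
    refine Finset.sum_bij (fun m _ => (m : ℤ)) ?_ ?_ ?_ ?_
    · intro m hm
      simp only [hI, Finset.mem_filter, Finset.mem_Icc] at hm ⊢
      refine ⟨by exact_mod_cast hm.1.1, ?_⟩
      have : m ≤ N / max p l := by
        rw [Nat.le_div_iff_mul_le hmax0, mul_comm]
        exact hm.2
      exact Int.ofNat_le.2 this
    · intro m _ m' _ h
      exact_mod_cast h
    · intro x hx
      rw [Finset.mem_Icc] at hx
      refine ⟨x.toNat, ?_, by omega⟩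
      have h5 : x.toNat ≤ N / max p l := Int.toNat_le.2 hx.2
      have h6 : N / max p l ≤ N / Y :=
        Nat.div_le_div_left ((hs p hp).trans (le_max_left _ _)) hY
      simp only [hI, Finset.mem_filter, Finset.mem_Icc]
      refine ⟨⟨by omega, by omega⟩, ?_⟩
      rw [Nat.le_div_iff_mul_le hmax0, mul_comm] at h5
      exact h5
    · intro m _
      rfl
  rw [h1]
  calc ‖∑ m ∈ I with m ∈ A, ∑ p ∈ s, t p m‖ ^ 2
      ≤ (∑ m ∈ I with m ∈ A, ‖∑ p ∈ s, t p m‖) ^ 2 := by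
        gcongr
        exact norm_sum_le _ _
    _ ≤ (∑ m ∈ I, ‖∑ p ∈ s, t p m‖) ^ 2 := by
        gcongr
        exact Finset.filter_subset _ _
    _ ≤ I.card * ∑ m ∈ I, ‖∑ p ∈ s, t p m‖ ^ 2 := sq_sum_le_card_mul_sum_sq
    _ ≤ _ := by
        rw [hI, Nat.card_Icc, Nat.add_sub_cancel]
        refine mul_le_mul_of_nonneg_left ?_ (Nat.cast_nonneg _)
        have h5 : ∑ m ∈ I, ‖∑ p ∈ s, t p m‖ ^ 2 =
            ‖((∑ m ∈ I, ‖∑ p ∈ s, t p m‖ ^ 2 : ℝ) : ℂ)‖ := by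
          rw [Complex.norm_real, Real.norm_of_nonneg (by positivity)]
        rw [h5, h3]
        refine (norm_sum_le _ _).trans (Finset.sum_le_sum fun p hp => ?_)
        refine (norm_sum_le _ _).trans (Finset.sum_le_sum fun l hl => ?_)
        rw [norm_mul, norm_mul, Complex.norm_real, Complex.norm_real,
          Real.norm_of_nonneg (hw p hp), Real.norm_of_nonneg (hw l hl)]

theorem exists_many_large_correlations {s : Finset ℕ} {w : ℕ → ℝ} {V : ℕ → ℕ → ℝ} {X Y T : ℝ}
    (hX : 0 < X) (hT : 1 ≤ T) (hY : 250000 * T ^ 4 ≤ Y) (hw : ∀ p ∈ s, 0 ≤ w p)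
    (hw' : ∀ p ∈ s, w p ≤ 3 * √Y) (hsum : ∑ p ∈ s, w p ≤ 3 * Y)
    (hV : ∀ p ∈ s, ∀ l ∈ s, V p l ≤ X)
    (hbig : X * Y ^ 2 / (4 * T ^ 2) ≤ ∑ p ∈ s, ∑ l ∈ s, w l * (w p * V p l)) :
    ∃ l ∈ s, Y / (25 * T ^ 2) ≤ ∑ p ∈ s with p ≠ l ∧ X / (100 * T ^ 2) ≤ V p l, w p := by
  have hT2 : 0 < T ^ 2 := by positivity
  have hY0 : 0 < Y := lt_of_lt_of_le (by positivity) hY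
  obtain ⟨l, hl, hlarge⟩ : ∃ l ∈ s, X * Y / (13 * T ^ 2) ≤ ∑ p ∈ s, w p * V p l := by
    by_contra! hcon
    have h1 : ∑ p ∈ s, ∑ l ∈ s, w l * (w p * V p l) ≤ X * Y / (13 * T ^ 2) * (3 * Y) := by
      rw [Finset.sum_comm]
      calc _ = ∑ l ∈ s, w l * ∑ p ∈ s, w p * V p l := by
            simp only [Finset.mul_sum]
        _ ≤ ∑ l ∈ s, w l * (X * Y / (13 * T ^ 2)) :=
            Finset.sum_le_sum fun l hl => mul_le_mul_of_nonneg_left (hcon l hl).le (hw l hl)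
        _ = X * Y / (13 * T ^ 2) * ∑ l ∈ s, w l := by rw [← Finset.sum_mul, mul_comm]
        _ ≤ _ := by gcongr
    have h2 : X * Y / (13 * T ^ 2) * (3 * Y) < X * Y ^ 2 / (4 * T ^ 2) := by
      have h3 : X * Y / (13 * T ^ 2) * (3 * Y) = (X * Y ^ 2 / T ^ 2) * (3 / 13) := by
        field_simp
      have h4 : X * Y ^ 2 / (4 * T ^ 2) = (X * Y ^ 2 / T ^ 2) * (1 / 4) := by
        field_simp
      rw [h3, h4]
      have : 0 < X * Y ^ 2 / T ^ 2 := by positivity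
      linarith
    linarith
  refine ⟨l, hl, ?_⟩
  set G := s.filter (fun p => p ≠ l ∧ X / (100 * T ^ 2) ≤ V p l) with hG
  have hterm : ∀ p ∈ s, w p * V p l ≤ (if p = l then w l * X else 0) +
      ((if p ≠ l ∧ X / (100 * T ^ 2) ≤ V p l then w p * X else 0) +
        w p * (X / (100 * T ^ 2))) := by
    intro p hp
    have h0 : 0 ≤ w p * (X / (100 * T ^ 2)) := mul_nonneg (hw p hp) (by positivity)
    by_cases h1 : p = l
    · have := mul_le_mul_of_nonneg_left (hV p hp l hl) (hw p hp)
      subst h1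
      simp only [if_true, ne_eq, not_true_eq_false, false_and, if_false]
      linarith
    · by_cases h2 : X / (100 * T ^ 2) ≤ V p l
      · have := mul_le_mul_of_nonneg_left (hV p hp l hl) (hw p hp)
        simp only [h1, if_false, ne_eq, not_false_eq_true, h2, and_self, if_true]
        linarith
      · have := mul_le_mul_of_nonneg_left (not_le.1 h2).le (hw p hp)
        simp only [h1, if_false, ne_eq, not_false_eq_true, h2, and_false]
        linarith
  have h1 := hlarge.trans (Finset.sum_le_sum hterm)
  rw [Finset.sum_add_distrib, Finset.sum_add_distrib, Finset.sum_ite_eq' s l, if_pos hl,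
    ← Finset.sum_filter, ← hG, ← Finset.sum_mul, ← Finset.sum_mul] at h1
  have h2 : (∑ p ∈ s, w p) * (X / (100 * T ^ 2)) ≤ 3 * Y * (X / (100 * T ^ 2)) := by gcongr
  have h3 : w l * X ≤ 3 * √Y * X := by gcongr; exact hw' l hl
  have h4 : X * (Y / (13 * T ^ 2)) ≤
      X * (3 * √Y + (∑ p ∈ G, w p) + 3 * Y / (100 * T ^ 2)) := by
    calc X * (Y / (13 * T ^ 2)) = X * Y / (13 * T ^ 2) := by ring
      _ ≤ _ := h1
      _ ≤ 3 * √Y * X + ((∑ p ∈ G, w p) * X + 3 * Y * (X / (100 * T ^ 2))) := by gcongr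
      _ = _ := by ring
  have h5 := le_of_mul_le_mul_left h4 hX
  have h6 : 500 * T ^ 2 ≤ √Y := by
    apply Real.le_sqrt_of_sq_le
    nlinarith
  have h7 : 3 * √Y ≤ 3 * (Y / (500 * T ^ 2)) := by
    have h8 : √Y * (500 * T ^ 2) ≤ Y := by
      calc √Y * (500 * T ^ 2) ≤ √Y * √Y := by gcongr
        _ = Y := Real.mul_self_sqrt hY0.le
    have h9 : √Y ≤ Y / (500 * T ^ 2) := (le_div_iff₀ (by positivity)).2 h8
    linarith
  have e1 : Y / (13 * T ^ 2) = Y / T ^ 2 * (1 / 13) := by field_simp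
  have e2 : 3 * Y / (100 * T ^ 2) = Y / T ^ 2 * (3 / 100) := by field_simp
  have e3 : Y / (500 * T ^ 2) = Y / T ^ 2 * (1 / 500) := by field_simp
  have e4 : Y / (25 * T ^ 2) = Y / T ^ 2 * (1 / 25) := by field_simp
  have h10 : 0 < Y / T ^ 2 := by positivity
  rw [e4]
  rw [e1, e2] at h5
  rw [e3] at h7
  linarith

theorem sum_log_primes_dyadic_le (Y : ℕ) (s : Finset ℕ) (hs : ∀ p ∈ s, p.Prime ∧ p < 2 * Y) :
    ∑ p ∈ s, Real.log p ≤ 3 * Y := by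
  have h1 : ∑ p ∈ s, Real.log p ≤ Chebyshev.theta ((2 * Y : ℕ) : ℝ) := by
    rw [Chebyshev.theta, Nat.floor_natCast]
    refine Finset.sum_le_sum_of_subset_of_nonneg ?_ fun p hp _ => Real.log_natCast_nonneg p
    intro p hp
    rw [Finset.mem_filter, Finset.mem_Ioc]
    exact ⟨⟨(hs p hp).1.pos, (hs p hp).2.le⟩, (hs p hp).1⟩
  have h2 := Chebyshev.theta_le_log4_mul_x (x := ((2 * Y : ℕ) : ℝ)) (Nat.cast_nonneg _)
  have h3 : Real.log 4 ≤ 1.4 := by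
    rw [show (4 : ℝ) = 2 ^ 2 by norm_num, Real.log_pow]
    have := Real.log_two_lt_d9
    push_cast
    linarith
  have h4 : (0 : ℝ) ≤ Y := Nat.cast_nonneg _
  push_cast at h1 h2
  nlinarith

theorem log_le_three_mul_sqrt {p Y : ℕ} (hp : 0 < p) (hpY : p < 2 * Y) :
    Real.log p ≤ 3 * √Y := by
  have hp0 : (0 : ℝ) < p := by exact_mod_cast hp
  have h1 : Real.log p = 2 * Real.log (√p) := by
    rw [Real.log_sqrt hp0.le]
    ring
  have h2 := Real.log_le_sub_one_of_pos (Real.sqrt_pos.2 hp0)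
  have h3 : √(p : ℝ) ≤ √(2 * Y) := Real.sqrt_le_sqrt (by exact_mod_cast hpY.le)
  have h4 : √(2 * Y : ℝ) ≤ 3 / 2 * √Y := by
    rw [Real.sqrt_mul (by norm_num)]
    gcongr
    rw [Real.sqrt_le_left (by norm_num)]
    norm_num
  linarith

set_option maxHeartbeats 1000000 in
theorem exists_rational_approx_of_large_bilinear :
    ∃ C : ℝ, 1 ≤ C ∧ ∀ (P T α : ℝ) (Y : ℕ) (s : Finset ℕ) (A : Set ℕ) [DecidablePred (· ∈ A)],
      1 ≤ T → C * T ^ 200 ≤ Y → (Y : ℝ) ^ 10 ≤ P →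
      (∀ p ∈ s, p.Prime ∧ Y ≤ p ∧ p < 2 * Y) →
      P / (2 * T) ≤ ‖∑ p ∈ s, (Real.log p : ℂ) *
        ∑ m ∈ Finset.Icc 1 (⌊P⌋₊ / Y) with m ∈ A ∧ p * m ≤ ⌊P⌋₊,
          e (α * ((p * m : ℕ) : ℝ) ^ 4)‖ →
      ∃ (q : ℕ) (a : ℤ), 1 ≤ q ∧ q ≤ C * T ^ 40 ∧ |α - a / q| ≤ C * T ^ 86 / P ^ 4 := by
  obtain ⟨C₁, hC₁, weyl⟩ := exists_rational_approx_of_large_weyl_sum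
  obtain ⟨C₂, hC₂, primes⟩ := exists_rational_approx_of_many_primes
  set C : ℝ := 250000 + 3 * C₁ * 100 ^ 120 + C₂ * (C₁ ^ 2 * 100 ^ 18 * 625) +
    32 * 81 * C₁ ^ 2 * 100 ^ 50 + C₂ * C₁ * (100 ^ 41 * 81 * 625) with hC
  have hC₁0 : 0 < C₁ := by linarith
  have hC₂0 : 0 < C₂ := by linarith
  have p1 : 0 < 3 * C₁ * 100 ^ 120 := by positivity
  have p2 : 0 < C₂ * (C₁ ^ 2 * 100 ^ 18 * 625) := by positivity
  have p3 : 0 < 32 * 81 * C₁ ^ 2 * 100 ^ 50 := by positivity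
  have p4 : 0 < C₂ * C₁ * (100 ^ 41 * 81 * 625) := by positivity
  have c0 : 250000 ≤ C := by linarith
  have c1 : 3 * C₁ * 100 ^ 120 ≤ C := by linarith
  have c2 : C₂ * (C₁ ^ 2 * 100 ^ 18 * 625) ≤ C := by linarith
  have c3 : 32 * 81 * C₁ ^ 2 * 100 ^ 50 ≤ C := by linarith
  have c4 : C₂ * C₁ * (100 ^ 41 * 81 * 625) ≤ C := by linarith
  clear_value C
  refine ⟨C, by linarith, fun P T α Y s A _ hT hCY hYP hs hbig => ?_⟩
  have hT0 : 0 < T := by linarith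
  have hYC : C ≤ Y := by
    have : (1 : ℝ) ≤ T ^ 200 := one_le_pow₀ hT
    nlinarith
  have hY1 : (1 : ℝ) ≤ Y := by linarith
  have hY0 : (0 : ℝ) < Y := by linarith
  have hYn : 0 < Y := by exact_mod_cast hY0
  have hP1 : 1 ≤ P := (one_le_pow₀ hY1).trans hYP
  have hP0 : 0 < P := by linarith
  have hYpow : ∀ k : ℕ, k ≤ 10 → (Y : ℝ) ^ k ≤ P := fun k hk =>
    (pow_le_pow_right₀ hY1 hk).trans hYP
  have hN : ((⌊P⌋₊ : ℕ) : ℝ) ≤ P := Nat.floor_le hP0.le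
  have hN' : P < ((⌊P⌋₊ : ℕ) : ℝ) + 1 := Nat.lt_floor_add_one P
  set N := ⌊P⌋₊ with hNdef
  set V : ℕ → ℕ → ℝ := fun p l => ‖∑ x ∈ Finset.Icc (1 : ℤ) ((N / max p l : ℕ) : ℤ),
          e (α * ((p : ℝ) ^ 4 - (l : ℝ) ^ 4) * x ^ 4)‖ with hVdef
  have hNX : ∀ k : ℕ, Y ≤ k → ((N / k : ℕ) : ℝ) ≤ P / Y := by
    intro k hk
    refine Nat.cast_div_le.trans ?_
    gcongr
  have hbil := norm_sq_bilinear_le α hYn s (fun p hp => (hs p hp).2.1) (fun p => Real.log p)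
    (fun p _ => Real.log_natCast_nonneg p) (N := N) A
  have hS0 : 0 ≤ ∑ p ∈ s, ∑ l ∈ s, Real.log l * (Real.log p * V p l) :=
    Finset.sum_nonneg fun p _ => Finset.sum_nonneg fun l _ =>
      mul_nonneg (Real.log_natCast_nonneg l) (mul_nonneg (Real.log_natCast_nonneg p)
        (norm_nonneg _))
  have hbig2 : P / Y * (Y : ℝ) ^ 2 / (4 * T ^ 2) ≤
      ∑ p ∈ s, ∑ l ∈ s, Real.log l * (Real.log p * V p l) := by
    have h1 : (P / (2 * T)) ^ 2 ≤ P / Y * ∑ p ∈ s, ∑ l ∈ s, Real.log l * (Real.log p * V p l) :=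
      (pow_le_pow_left₀ (by positivity) hbig 2).trans
        (hbil.trans (mul_le_mul_of_nonneg_right (hNX Y le_rfl) hS0))
    refine le_of_mul_le_mul_left (le_trans (le_of_eq ?_) h1) (show 0 < P / Y by positivity)
    field_simp
    norm_num
  have hV : ∀ p ∈ s, ∀ l ∈ s, V p l ≤ P / Y := by
    intro p hp l hl
    refine (norm_sum_le _ _).trans ?_
    simp only [norm_e, Finset.sum_const, nsmul_eq_mul, mul_one, Int.card_Icc]
    rw [add_sub_cancel_right, Int.toNat_natCast]
    exact hNX _ ((hs p hp).2.1.trans (le_max_left _ _))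
  have hYT4 : 250000 * T ^ 4 ≤ (Y : ℝ) := by
    refine le_trans ?_ hCY
    have : T ^ 4 ≤ T ^ 200 := pow_le_pow_right₀ hT (by norm_num)
    gcongr
  obtain ⟨l, hl, hG⟩ := exists_many_large_correlations (s := s) (w := fun p => Real.log p)
    (V := V) (show 0 < P / Y by positivity) hT hYT4 (fun p _ => Real.log_natCast_nonneg p)
    (fun p hp => log_le_three_mul_sqrt (hs p hp).1.pos (hs p hp).2.2)
    (sum_log_primes_dyadic_le Y s fun p hp => ⟨(hs p hp).1, (hs p hp).2.2⟩) hV hbig2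
  set G := s.filter (fun p => p ≠ l ∧ P / Y / (100 * T ^ 2) ≤ V p l) with hGdef
  have hT2 : 1 ≤ T ^ 2 := one_le_pow₀ hT
  have hU1 : 1 ≤ 100 * T ^ 2 := by linarith
  set δ : ℝ := C₁ * (100 * T ^ 2) ^ 41 * (3 * Y / P) ^ 4 with hδ
  have hAκ : (C₁ * (100 * T ^ 2) ^ 9 / (1 / (25 * T ^ 2))) ^ 2 =
      C₁ ^ 2 * 100 ^ 18 * 625 * T ^ 40 := by
    field_simp
    ring
  have hres := primes Y l (C₁ * (100 * T ^ 2) ^ 9) (1 / (25 * T ^ 2)) δ α G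
    (by
      have : (1 : ℝ) ≤ (100 * T ^ 2) ^ 9 := one_le_pow₀ hU1
      nlinarith)
    (by positivity)
    (by
      rw [div_le_one (by positivity)]
      linarith)
    (by
      rw [hAκ]
      refine le_trans ?_ hCY
      have : T ^ 40 ≤ T ^ 200 := pow_le_pow_right₀ hT (by norm_num)
      rw [← mul_assoc]
      gcongr)
    (by positivity)
    (by
      have h1 : 32 * (C₁ * (100 * T ^ 2) ^ 9) * (Y : ℝ) ^ 4 * δ =
          (32 * 81 * C₁ ^ 2 * 100 ^ 50 * T ^ 100) * ((Y : ℝ) ^ 8 / P ^ 4) := by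
        rw [hδ]
        field_simp
        ring
      rw [h1, ← mul_div_assoc, div_lt_one (by positivity)]
      have h2 : 32 * 81 * C₁ ^ 2 * 100 ^ 50 * T ^ 100 ≤ Y := by
        refine le_trans ?_ hCY
        have : T ^ 100 ≤ T ^ 200 := pow_le_pow_right₀ hT (by norm_num)
        gcongr
      calc 32 * 81 * C₁ ^ 2 * 100 ^ 50 * T ^ 100 * (Y : ℝ) ^ 8 ≤ Y * (Y : ℝ) ^ 8 := by gcongr
        _ = (Y : ℝ) ^ 9 := by ring
        _ < (Y : ℝ) ^ 10 := pow_lt_pow_right₀ (by linarith) (by norm_num)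
        _ ≤ P := hYP
        _ ≤ P ^ 4 := le_self_pow₀ hP1 (by norm_num))
    (hs l hl).1 (hs l hl).2.1 (hs l hl).2.2
    (fun p hp => by
      have := hs p (Finset.mem_filter.1 hp).1
      exact ⟨this.1, this.2.1, this.2.2, (Finset.mem_filter.1 hp).2.1⟩)
    (by
      refine le_trans (le_of_eq ?_) hG
      ring)
    (by
      intro p hp
      obtain ⟨hps, -, hpV⟩ := Finset.mem_filter.1 hp
      have hYm : Y ≤ max p l := (hs p hps).2.1.trans (le_max_left _ _)
      have hm : max p l ≤ 2 * Y := max_le (hs p hps).2.2.le (hs l hl).2.2.le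
      have hm0 : 0 < max p l := lt_of_lt_of_le hYn hYm
      have hY2 : 250000 * (Y : ℝ) ≤ P :=
        le_trans (by nlinarith) (hYpow 2 (by norm_num))
      have hM : P / (3 * Y) ≤ ((N / max p l : ℕ) : ℝ) := by
        have h1 : (N : ℝ) < ((N / max p l : ℕ) + 1) * (max p l : ℕ) := by
          have := Nat.lt_div_mul_add (a := N) hm0
          have h2 : N < (N / max p l + 1) * max p l := by
            rw [add_mul, one_mul]
            exact this
          exact_mod_cast h2
        have h3 : ((max p l : ℕ) : ℝ) ≤ 2 * Y := by exact_mod_cast hm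
        have h4 : (((N / max p l : ℕ) : ℝ) + 1) * ((max p l : ℕ) : ℝ) ≤
            (((N / max p l : ℕ) : ℝ) + 1) * (2 * Y) := by gcongr
        rw [div_le_iff₀ (by positivity)]
        nlinarith
      obtain ⟨r, b, hr, hrA, hrb⟩ := weyl (N / max p l) (α * ((p : ℝ) ^ 4 - (l : ℝ) ^ 4))
        (100 * T ^ 2) hU1
        (by
          refine le_trans ?_ hM
          rw [le_div_iff₀ (by positivity)]
          calc C₁ * (100 * T ^ 2) ^ 120 * (3 * Y) = (3 * C₁ * 100 ^ 120 * T ^ 240) * Y := by ring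
            _ ≤ (C * T ^ 400) * Y := by
              have : T ^ 240 ≤ T ^ 400 := pow_le_pow_right₀ hT (by norm_num)
              gcongr
            _ ≤ (C * C * T ^ 400) * Y := by
              gcongr
              nlinarith
            _ = (C * T ^ 200) ^ 2 * Y := by ring
            _ ≤ (Y : ℝ) ^ 2 * Y := by gcongr
            _ = (Y : ℝ) ^ 3 := by ring
            _ ≤ P := hYpow 3 (by norm_num))
        (by
          refine le_trans ?_ hpV
          have := hNX _ hYm
          gcongr)
      refine ⟨r, b, hr, hrA, hrb.trans ?_⟩
      rw [hδ, div_eq_mul_inv, ← inv_pow]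
      gcongr
      rw [inv_le_comm₀ (lt_of_lt_of_le (by positivity) hM) (by positivity), inv_div]
      exact hM)
  obtain ⟨q, a, hq, hqC, ha⟩ := hres
  refine ⟨q, a, hq, hqC.trans ?_, ha.trans ?_⟩
  · rw [hAκ, ← mul_assoc]
    gcongr
  · have h1 : C₂ * δ / ((1 / (25 * T ^ 2)) ^ 2 * (Y : ℝ) ^ 4) =
        C₂ * C₁ * (100 ^ 41 * 81 * 625) * T ^ 86 / P ^ 4 := by
      rw [hδ]
      field_simp
      ring
    rw [h1]
    gcongr

theorem sum_log_sub_log_le {P : ℝ} (hP : 1 ≤ P) :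
    ∑ x ∈ Finset.Icc 1 ⌊P⌋₊, (Real.log P - Real.log x) ≤ P := by
  have h1 : ∑ x ∈ Finset.Icc 1 ⌊P⌋₊, Real.log x = Real.log ((⌊P⌋₊.factorial : ℕ) : ℝ) := by
    rw [← Finset.prod_Ico_id_eq_factorial, Finset.Ico_add_one_right_eq_Icc, Nat.cast_prod, Real.log_prod]
    intro x hx
    rw [Finset.mem_Icc] at hx
    have : x ≠ 0 := by omega
    exact_mod_cast this
  rw [Finset.sum_sub_distrib, h1, Finset.sum_const, Nat.card_Icc, Nat.add_sub_cancel, nsmul_eq_mul,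
    ← Real.log_pow, ← Real.log_div (by positivity) (by positivity)]
  calc Real.log (P ^ ⌊P⌋₊ / (⌊P⌋₊.factorial : ℕ)) ≤ Real.log (Real.exp P) :=
        Real.log_le_log (by positivity) (Real.pow_div_factorial_le_exp P (by linarith) _)
    _ = P := Real.log_exp P

theorem norm_log_mul_sum_sub_le {P : ℝ} (hP : 1 ≤ P) {S : Finset ℕ}
    (hS : S ⊆ Finset.Icc 1 ⌊P⌋₊) {f : ℕ → ℂ} (hf : ∀ x, ‖f x‖ ≤ 1) :
    ‖(Real.log P : ℂ) * ∑ x ∈ S, f x - ∑ x ∈ S, (Real.log x : ℂ) * f x‖ ≤ P := by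
  have hlog : ∀ x ∈ Finset.Icc 1 ⌊P⌋₊, 0 ≤ Real.log P - Real.log x := by
    intro x hx
    rw [Finset.mem_Icc] at hx
    have h1 : (x : ℝ) ≤ P := (Nat.le_floor_iff (by linarith)).1 hx.2
    have h2 : (0 : ℝ) < x := by exact_mod_cast hx.1
    exact sub_nonneg.2 (Real.log_le_log h2 h1)
  rw [Finset.mul_sum, ← Finset.sum_sub_distrib]
  refine (norm_sum_le _ _).trans (le_trans ?_ (sum_log_sub_log_le hP))
  refine le_trans (Finset.sum_le_sum fun x hx => ?_)
    (Finset.sum_le_sum_of_subset_of_nonneg hS fun x hx _ => hlog x hx)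
  rw [← sub_mul, norm_mul, ← Complex.ofReal_sub, Complex.norm_real,
    Real.norm_of_nonneg (hlog x (hS hx))]
  exact mul_le_of_le_one_right (hlog x (hS hx)) (hf x)

theorem sum_log_mul_eq_sum_vonMangoldt {N : ℕ} {S : Finset ℕ} (hS : S ⊆ Finset.Icc 1 N)
    (f : ℕ → ℂ) :
    ∑ x ∈ S, (Real.log x : ℂ) * f x = ∑ n ∈ Finset.Icc 1 N,
      (ArithmeticFunction.vonMangoldt n : ℂ) * ∑ m ∈ Finset.Icc 1 N with n * m ∈ S, f (n * m) := by
  have h1 : ∀ x ∈ S, (Real.log x : ℂ) * f x =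
      ∑ d ∈ x.divisorsAntidiagonal, (ArithmeticFunction.vonMangoldt d.1 : ℂ) * f (d.1 * d.2) := by
    intro x hx
    rw [← ArithmeticFunction.vonMangoldt_sum, Complex.ofReal_sum, Finset.sum_mul,
      ← Nat.map_div_right_divisors, Finset.sum_map]
    refine Finset.sum_congr rfl fun d hd => ?_
    change _ = (ArithmeticFunction.vonMangoldt d : ℂ) * f (d * (x / d))
    rw [Nat.mul_div_cancel' (Nat.dvd_of_mem_divisors hd)]
  simp only [Finset.mul_sum]
  rw [Finset.sum_congr rfl h1, Finset.sum_sigma', Finset.sum_sigma']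
  refine Finset.sum_bij' (fun a _ => ⟨a.2.1, a.2.2⟩) (fun b _ => ⟨b.1 * b.2, (b.1, b.2)⟩)
    ?_ ?_ ?_ ?_ ?_
  · rintro ⟨x, n, m⟩ hx
    simp only [Finset.mem_sigma, Nat.mem_divisorsAntidiagonal, Finset.mem_filter,
      Finset.mem_Icc] at hx ⊢
    obtain ⟨hxS, rfl, h0⟩ := hx
    have h2 := Finset.mem_Icc.1 (hS hxS)
    have hn : 1 ≤ n := Nat.one_le_iff_ne_zero.2 (left_ne_zero_of_mul h0)
    have hm : 1 ≤ m := Nat.one_le_iff_ne_zero.2 (right_ne_zero_of_mul h0)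
    exact ⟨⟨hn, (Nat.le_mul_of_pos_right n hm).trans h2.2⟩,
      ⟨hm, (Nat.le_mul_of_pos_left m hn).trans h2.2⟩, hxS⟩
  · rintro ⟨n, m⟩ hb
    simp only [Finset.mem_sigma, Nat.mem_divisorsAntidiagonal, Finset.mem_filter,
      Finset.mem_Icc] at hb ⊢
    exact ⟨hb.2.2, trivial, mul_ne_zero (by omega) (by omega)⟩
  · rintro ⟨x, n, m⟩ hx
    simp only [Finset.mem_sigma, Nat.mem_divisorsAntidiagonal] at hx
    obtain ⟨-, rfl, -⟩ := hx
    rfl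
  · rintro ⟨n, m⟩ _
    rfl
  · rintro ⟨x, n, m⟩ _
    rfl

theorem norm_sum_multiples_le {P : ℝ} (hP : 0 ≤ P) {n : ℕ} (hn : 0 < n) {S : Finset ℕ}
    (hS : S ⊆ Finset.Icc 1 ⌊P⌋₊) {f : ℕ → ℂ} (hf : ∀ x, ‖f x‖ ≤ 1) :
    ‖∑ m ∈ Finset.Icc 1 ⌊P⌋₊ with n * m ∈ S, f (n * m)‖ ≤ P / n := by
  refine (norm_sum_le _ _).trans ((Finset.sum_le_sum fun m _ => hf (n * m)).trans ?_)
  rw [Finset.sum_const, nsmul_eq_mul, mul_one]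
  have h1 : (Finset.Icc 1 ⌊P⌋₊).filter (fun m => n * m ∈ S) ⊆ Finset.Icc 1 (⌊P⌋₊ / n) := by
    intro m hm
    rw [Finset.mem_filter, Finset.mem_Icc] at hm
    have h2 := Finset.mem_Icc.1 (hS hm.2)
    rw [Finset.mem_Icc, Nat.le_div_iff_mul_le hn, mul_comm]
    exact ⟨hm.1.1, h2.2⟩
  have h2 := Finset.card_le_card h1
  rw [Nat.card_Icc, Nat.add_sub_cancel] at h2
  calc ((((Finset.Icc 1 ⌊P⌋₊).filter (fun m => n * m ∈ S)).card : ℕ) : ℝ)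
      ≤ ((⌊P⌋₊ / n : ℕ) : ℝ) := by exact_mod_cast h2
    _ ≤ (⌊P⌋₊ : ℝ) / n := Nat.cast_div_le
    _ ≤ P / n := by
      gcongr
      exact Nat.floor_le hP

theorem norm_sum_vonMangoldt_le {P : ℝ} (hP : 0 ≤ P) {Y : ℕ} (hY : 0 < Y) {S s : Finset ℕ}
    (hS : S ⊆ Finset.Icc 1 ⌊P⌋₊) {f : ℕ → ℂ} (hf : ∀ x, ‖f x‖ ≤ 1) (hs : ∀ n ∈ s, Y ≤ n) :
    ‖∑ n ∈ s, (ArithmeticFunction.vonMangoldt n : ℂ) *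
        ∑ m ∈ Finset.Icc 1 ⌊P⌋₊ with n * m ∈ S, f (n * m)‖ ≤
      P / Y * ∑ n ∈ s, ArithmeticFunction.vonMangoldt n := by
  rw [Finset.mul_sum]
  refine (norm_sum_le _ _).trans (Finset.sum_le_sum fun n hn => ?_)
  rw [norm_mul, Complex.norm_real, Real.norm_of_nonneg ArithmeticFunction.vonMangoldt_nonneg,
    mul_comm]
  refine mul_le_mul_of_nonneg_right ?_ ArithmeticFunction.vonMangoldt_nonneg
  refine (norm_sum_multiples_le hP (hY.trans_le (hs n hn)) hS hf).trans ?_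
  have : (0 : ℝ) < Y := by exact_mod_cast hY
  have := hs n hn
  gcongr

theorem sum_vonMangoldt_dyadic_le {Y : ℕ} {s : Finset ℕ} (hs : ∀ n ∈ s, n < 2 * Y) :
    ∑ n ∈ s, ArithmeticFunction.vonMangoldt n ≤ 11 * Y := by
  have h1 : ∑ n ∈ s, ArithmeticFunction.vonMangoldt n ≤ Chebyshev.psi ((2 * Y : ℕ) : ℝ) := by
    rw [Chebyshev.psi, Nat.floor_natCast]
    rw [← Finset.sum_filter_add_sum_filter_not s (fun n => 0 < n)]
    have h2 : ∑ n ∈ s with ¬ 0 < n, ArithmeticFunction.vonMangoldt n = 0 := by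
      refine Finset.sum_eq_zero fun n hn => ?_
      have := (Finset.mem_filter.1 hn).2
      rw [show n = 0 by omega]
      simp
    rw [h2, add_zero]
    refine Finset.sum_le_sum_of_subset_of_nonneg ?_
      fun n _ _ => ArithmeticFunction.vonMangoldt_nonneg
    intro n hn
    rw [Finset.mem_filter] at hn
    rw [Finset.mem_Ioc]
    exact ⟨hn.2, (hs n hn.1).le⟩
  have h2 := Chebyshev.psi_le_const_mul_self (x := ((2 * Y : ℕ) : ℝ)) (Nat.cast_nonneg _)
  have h3 : Real.log 4 ≤ 1.5 := by
    rw [show (4 : ℝ) = 2 ^ 2 by norm_num, Real.log_pow]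
    have := Real.log_two_lt_d9
    push_cast
    linarith
  have h4 : (0 : ℝ) ≤ Y := Nat.cast_nonneg _
  push_cast at h1 h2
  nlinarith

theorem sum_vonMangoldt_not_prime_le {Y : ℕ} {T : ℝ} (hT : 1 ≤ T) (hY : (32 * T) ^ 4 ≤ Y)
    {s : Finset ℕ} (hs : ∀ n ∈ s, ¬ n.Prime ∧ n < 2 * Y) :
    ∑ n ∈ s, ArithmeticFunction.vonMangoldt n ≤ Y / (2 * T) := by
  have hT0 : 0 < T := by linarith
  have hY0 : (0 : ℝ) < Y := lt_of_lt_of_le (by positivity) hY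
  have hY1 : (1 : ℝ) ≤ 2 * Y := by
    have : 0 < Y := by exact_mod_cast hY0
    have : 1 ≤ 2 * Y := by omega
    exact_mod_cast this
  have h1 : ∑ n ∈ s, ArithmeticFunction.vonMangoldt n ≤
      Chebyshev.psi (2 * Y) - Chebyshev.theta (2 * Y) := by
    rw [Chebyshev.psi_sub_theta_eq_sum_not_prime,
      show (2 * Y : ℝ) = ((2 * Y : ℕ) : ℝ) by push_cast; rfl, Nat.floor_natCast]
    rw [← Finset.sum_filter_add_sum_filter_not s (fun n => 0 < n)]
    have h2 : ∑ n ∈ s with ¬ 0 < n, ArithmeticFunction.vonMangoldt n = 0 := by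
      refine Finset.sum_eq_zero fun n hn => ?_
      have := (Finset.mem_filter.1 hn).2
      rw [show n = 0 by omega]
      simp
    rw [h2, add_zero]
    refine Finset.sum_le_sum_of_subset_of_nonneg ?_
      fun n _ _ => ArithmeticFunction.vonMangoldt_nonneg
    intro n hn
    rw [Finset.mem_filter] at hn
    rw [Finset.mem_filter, Finset.mem_Ioc]
    exact ⟨⟨hn.2, (hs n hn.1).2.le⟩, (hs n hn.1).1⟩
  have h2 := Chebyshev.psi_sub_theta_le hY1
  set z := √√(2 * Y : ℝ) with hz
  have hz2 : z ^ 2 = √(2 * Y : ℝ) := Real.sq_sqrt (Real.sqrt_nonneg _)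
  have hz4 : z ^ 4 = 2 * Y := by
    rw [show z ^ 4 = (z ^ 2) ^ 2 by ring, hz2, Real.sq_sqrt (by linarith)]
  have hz0 : 0 < z := Real.sqrt_pos.2 (Real.sqrt_pos.2 (by linarith))
  have hlog : Real.log (2 * Y) ≤ 4 * z := by
    rw [← hz4, Real.log_pow]
    have := Real.log_le_sub_one_of_pos hz0
    push_cast
    linarith
  have hzT : 32 * T ≤ z := by
    refine le_of_pow_le_pow_left₀ (n := 4) (by norm_num) hz0.le ?_
    rw [hz4]
    linarith
  refine (h1.trans h2).trans ?_
  rw [← hz2, le_div_iff₀ (by positivity)]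
  calc 2 * z ^ 2 * Real.log (2 * Y) * (2 * T) ≤ 2 * z ^ 2 * (4 * z) * (2 * T) := by gcongr
    _ = z ^ 3 * (32 * T) / 2 := by ring
    _ ≤ z ^ 3 * z / 2 := by gcongr
    _ = z ^ 4 / 2 := by ring
    _ = Y := by linarith

theorem exists_large_dyadic_block {P T : ℝ} (hP : 1 ≤ P) (hT : 1 ≤ T) (hTP : T ≤ Real.log P / T)
    {S : Finset ℕ} (hS : S ⊆ Finset.Icc 1 ⌊P⌋₊) {f : ℕ → ℂ} (hf : ∀ x, ‖f x‖ ≤ 1)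
    (hlarge : 26 * P / T ≤ ‖∑ x ∈ S, f x‖) :
    ∃ j : ℕ, Real.log P / T ≤ j ∧ P / T ≤ ‖∑ n ∈ Finset.Icc 1 ⌊P⌋₊ with Nat.log 2 n = j,
      (ArithmeticFunction.vonMangoldt n : ℂ) *
        ∑ m ∈ Finset.Icc 1 ⌊P⌋₊ with n * m ∈ S, f (n * m)‖ := by
  by_contra! hcon
  have hT0 : 0 < T := by linarith
  have hP0 : 0 < P := by linarith
  set L := Real.log P with hL
  have hLT : T ≤ L := hTP.trans (div_le_self (Real.log_nonneg hP) hT)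
  set N := ⌊P⌋₊ with hN
  have hN1 : 1 ≤ N := Nat.le_floor (by simpa using hP)
  set J := Nat.log 2 N + 1 with hJ
  have hJL : (J : ℝ) ≤ 2.5 * L := by
    have h1 : ((2 ^ Nat.log 2 N : ℕ) : ℝ) ≤ P :=
      (Nat.cast_le.2 (Nat.pow_log_le_self 2 (by omega))).trans (Nat.floor_le hP0.le)
    have h2 : Real.log ((2 ^ Nat.log 2 N : ℕ) : ℝ) ≤ L := Real.log_le_log (by positivity) h1
    rw [Nat.cast_pow, Real.log_pow] at h2
    have h3 := Real.log_two_gt_d9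
    have h4 : (0 : ℝ) ≤ (Nat.log 2 N : ℝ) := Nat.cast_nonneg _
    have h5 : (Nat.log 2 N : ℝ) * 0.6931471803 ≤ (Nat.log 2 N : ℝ) * Real.log 2 := by gcongr
    rw [hJ]
    push_cast at h2 ⊢
    linarith
  set F : ℕ → ℂ := fun n => (ArithmeticFunction.vonMangoldt n : ℂ) *
        ∑ m ∈ Finset.Icc 1 N with n * m ∈ S, f (n * m) with hF
  have hblock : ∀ j ∈ Finset.range J, ‖∑ n ∈ Finset.Icc 1 N with Nat.log 2 n = j, F n‖ ≤
      (if (j : ℝ) < L / T then 11 * P else 0) + P / T := by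
    intro j _
    have hPT : 0 ≤ P / T := by positivity
    split_ifs with hj
    · have hmem : ∀ n ∈ (Finset.Icc 1 N).filter (fun n => Nat.log 2 n = j),
          2 ^ j ≤ n ∧ n < 2 * 2 ^ j := by
        intro n hn
        rw [Finset.mem_filter, Finset.mem_Icc] at hn
        have h1 := Nat.pow_log_le_self 2 (x := n) (by omega)
        have h2 := Nat.lt_pow_succ_log_self (b := 2) (by norm_num) n
        rw [hn.2] at h1 h2
        rw [pow_succ, mul_comm] at h2
        exact ⟨h1, h2⟩
      have h1 := norm_sum_vonMangoldt_le hP0.le (Y := 2 ^ j) (by positivity) hS hf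
        (fun n hn => (hmem n hn).1)
      have h2 := sum_vonMangoldt_dyadic_le (Y := 2 ^ j) (fun n hn => (hmem n hn).2)
      have h3 : P / ((2 ^ j : ℕ) : ℝ) * (11 * ((2 ^ j : ℕ) : ℝ)) = 11 * P := by
        field_simp
      have h4 : P / ((2 ^ j : ℕ) : ℝ) * ∑ n ∈ Finset.Icc 1 N with Nat.log 2 n = j,
          ArithmeticFunction.vonMangoldt n ≤ P / ((2 ^ j : ℕ) : ℝ) * (11 * ((2 ^ j : ℕ) : ℝ)) := by
        gcongr
      linarith
    · have := (hcon j (not_lt.1 hj)).le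
      linarith
  have hsum : ‖∑ n ∈ Finset.Icc 1 N, F n‖ ≤ (L / T + 1) * (11 * P) + 2.5 * L * (P / T) := by
    rw [← Finset.sum_fiberwise_of_maps_to (s := Finset.Icc 1 N) (t := Finset.range J)
      (g := fun n => Nat.log 2 n)]
    · refine (norm_sum_le _ _).trans ((Finset.sum_le_sum hblock).trans ?_)
      rw [Finset.sum_add_distrib, ← Finset.sum_filter, Finset.sum_const, Finset.sum_const,
        Finset.card_range, nsmul_eq_mul, nsmul_eq_mul]
      have h1 : (((Finset.range J).filter (fun j : ℕ => (j : ℝ) < L / T)).card : ℝ) ≤ L / T + 1 := by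
        have h2 : (Finset.range J).filter (fun j : ℕ => (j : ℝ) < L / T) ⊆
            Finset.range ⌈L / T⌉₊ := by
          intro j hj
          rw [Finset.mem_range, Nat.lt_ceil]
          exact (Finset.mem_filter.1 hj).2
        have h3 := Finset.card_le_card h2
        rw [Finset.card_range] at h3
        exact (Nat.cast_le.2 h3).trans (Nat.ceil_lt_add_one (by linarith)).le
      gcongr
    · intro n hn
      rw [Finset.mem_Icc] at hn
      rw [Finset.mem_range, hJ]
      exact Nat.lt_succ_of_le (Nat.log_mono_right hn.2)
  have h1 := norm_log_mul_sum_sub_le hP hS hf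
  rw [sum_log_mul_eq_sum_vonMangoldt hS] at h1
  have h2 : ‖(L : ℂ) * ∑ x ∈ S, f x‖ ≤ P + ((L / T + 1) * (11 * P) + 2.5 * L * (P / T)) := by
    calc _ ≤ _ := norm_le_norm_sub_add _ (∑ n ∈ Finset.Icc 1 N, F n)
      _ ≤ _ := add_le_add h1 hsum
  rw [norm_mul, Complex.norm_real, Real.norm_of_nonneg (by linarith)] at h2
  have h3 : L * (26 * P / T) ≤ L * ‖∑ x ∈ S, f x‖ :=
    mul_le_mul_of_nonneg_left hlarge (by linarith)
  have h4 : L * (26 * P / T) = 26 * (L / T * P) := by ring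
  have h5 : 2.5 * L * (P / T) = 2.5 * (L / T * P) := by ring
  have h6 : P ≤ L / T * P := by nlinarith
  nlinarith

theorem sum_prime_multiples_eq {P R : ℝ} {Y : ℕ} (hY : 0 < Y) {s : Finset ℕ}
    (hs : ∀ p ∈ s, p.Prime ∧ Y ≤ p) (α : ℝ) :
    ∑ p ∈ s, (ArithmeticFunction.vonMangoldt p : ℂ) *
        ∑ m ∈ Finset.Icc 1 ⌊P⌋₊ with p * m ∈ smoothA P R, e (α * ((p * m : ℕ) : ℝ) ^ 4) =
      ∑ p ∈ s.filter (fun p : ℕ => (p : ℝ) ≤ R), (Real.log p : ℂ) * ∑ m ∈ Finset.Icc 1 (⌊P⌋₊ / Y) with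
        m ∈ {m : ℕ | ∀ p ∈ m.primeFactors, (p : ℝ) ≤ R} ∧ p * m ≤ ⌊P⌋₊,
          e (α * ((p * m : ℕ) : ℝ) ^ 4) := by
  rw [Finset.sum_filter]
  refine Finset.sum_congr rfl fun p hp => ?_
  obtain ⟨hpp, hYp⟩ := hs p hp
  have hmem : ∀ m, 1 ≤ m → (p * m ∈ smoothA P R ↔
      (p : ℝ) ≤ R ∧ (∀ p ∈ m.primeFactors, (p : ℝ) ≤ R) ∧ p * m ≤ ⌊P⌋₊) := by
    intro m hm
    have hpm : 1 ≤ p * m := Nat.mul_pos hpp.pos hm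
    rw [smoothA, Finset.mem_filter, Finset.mem_Icc, Nat.primeFactors_mul hpp.ne_zero (by omega),
      hpp.primeFactors]
    constructor
    · rintro ⟨h1, h2⟩
      exact ⟨h2 p (by simp), fun r hr => h2 r (Finset.mem_union_right _ hr), h1.2⟩
    · rintro ⟨h1, h2, h3⟩
      refine ⟨⟨hpm, h3⟩, fun r hr => ?_⟩
      rw [Finset.mem_union, Finset.mem_singleton] at hr
      rcases hr with rfl | hr
      · exact h1
      · exact h2 r hr
  split_ifs with hpR
  · rw [ArithmeticFunction.vonMangoldt_apply_prime hpp]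
    congr 1
    refine Finset.sum_congr ?_ fun _ _ => rfl
    ext m
    simp only [Finset.mem_filter, Finset.mem_Icc, Set.mem_ofPred_eq]
    constructor
    · rintro ⟨h1, h2⟩
      obtain ⟨-, h3, h4⟩ := (hmem m h1.1).1 h2
      refine ⟨⟨h1.1, ?_⟩, h3, h4⟩
      rw [Nat.le_div_iff_mul_le hY, mul_comm]
      exact (Nat.mul_le_mul_right m hYp).trans h4
    · rintro ⟨h1, h2, h3⟩
      exact ⟨⟨h1.1, (Nat.le_mul_of_pos_left m hpp.pos).trans h3⟩, (hmem m h1.1).2 ⟨hpR, h2, h3⟩⟩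
  · rw [Finset.sum_eq_zero, mul_zero]
    intro m hm
    rw [Finset.mem_filter, Finset.mem_Icc] at hm
    exact absurd ((hmem m hm.1.1).1 hm.2).1 hpR

theorem exists_rational_approx_of_large_smooth_sum :
    ∃ C : ℝ, 1 ≤ C ∧ ∀ P R T α : ℝ, 1 ≤ P → R ≤ P ^ ((1 : ℝ) / 10) → 1 ≤ T →
      T ≤ Real.log P / T → C * T ^ 200 ≤ (2 : ℝ) ^ T → 26 * P / T ≤ ‖h P R α‖ →
      ∃ (q : ℕ) (a : ℤ), 1 ≤ q ∧ q ≤ C * T ^ 40 ∧ |α - a / q| ≤ C * T ^ 86 / P ^ 4 := by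
  classical
  obtain ⟨C₀, hC₀, bilinear⟩ := exists_rational_approx_of_large_bilinear
  refine ⟨C₀ + 32 ^ 4, by linarith, fun P R T α hP hR hT hTP h2T hlarge => ?_⟩
  have hP0 : 0 < P := by linarith
  have hT0 : 0 < T := by linarith
  have hS : smoothA P R ⊆ Finset.Icc 1 ⌊P⌋₊ := Finset.filter_subset _ _
  set f : ℕ → ℂ := fun x => e (α * (x : ℝ) ^ 4) with hf
  have hf1 : ∀ x, ‖f x‖ ≤ 1 := fun x => (norm_e _).le
  obtain ⟨j, hj, hB⟩ := exists_large_dyadic_block hP hT hTP hS hf1 hlarge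
  set Y := 2 ^ j with hY
  have hY0 : 0 < Y := by positivity
  have hYT : (C₀ + 32 ^ 4) * T ^ 200 ≤ (Y : ℝ) := by
    refine h2T.trans ?_
    rw [hY, Nat.cast_pow, Nat.cast_ofNat, ← Real.rpow_natCast]
    exact Real.rpow_le_rpow_of_exponent_le (by norm_num) (hTP.trans hj)
  have hT200 : 0 < T ^ 200 := by positivity
  set B := (Finset.Icc 1 ⌊P⌋₊).filter (fun n => Nat.log 2 n = j) with hBdef
  have hmem : ∀ n ∈ B, Y ≤ n ∧ n < 2 * Y := by
    intro n hn
    rw [hBdef, Finset.mem_filter, Finset.mem_Icc] at hn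
    have h1 := Nat.pow_log_le_self 2 (x := n) (by omega)
    have h2 := Nat.lt_pow_succ_log_self (b := 2) (by norm_num) n
    rw [hn.2] at h1 h2
    rw [pow_succ, mul_comm] at h2
    exact ⟨h1, h2⟩
  rw [← Finset.sum_filter_add_sum_filter_not B Nat.Prime] at hB
  have hnot : ‖∑ n ∈ B with ¬ n.Prime, (ArithmeticFunction.vonMangoldt n : ℂ) *
      ∑ m ∈ Finset.Icc 1 ⌊P⌋₊ with n * m ∈ smoothA P R, f (n * m)‖ ≤ P / (2 * T) := by
    refine (norm_sum_vonMangoldt_le hP0.le hY0 hS hf1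
      (fun n hn => (hmem n (Finset.mem_filter.1 hn).1).1)).trans ?_
    have h1 := sum_vonMangoldt_not_prime_le (Y := Y) (s := B.filter (fun n => ¬ n.Prime)) hT
      (by
        refine le_trans ?_ hYT
        have h2 : T ^ 4 ≤ T ^ 200 := pow_le_pow_right₀ hT (by norm_num)
        rw [mul_pow]
        nlinarith)
      (fun n hn => ⟨(Finset.mem_filter.1 hn).2, (hmem n (Finset.mem_filter.1 hn).1).2⟩)
    calc _ ≤ P / Y * (Y / (2 * T)) := by gcongr
      _ = P / (2 * T) := by
        have : (0 : ℝ) < Y := by exact_mod_cast hY0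
        field_simp
  rw [sum_prime_multiples_eq hY0 (fun p hp => ⟨(Finset.mem_filter.1 hp).2,
      (hmem p (Finset.mem_filter.1 hp).1).1⟩) α] at hB
  have hprime := hB.trans (norm_add_le _ _)
  have hhalf : P / T = P / (2 * T) + P / (2 * T) := by
    field_simp
    norm_num
  set s := (B.filter Nat.Prime).filter (fun p : ℕ => (p : ℝ) ≤ R) with hs
  have hsmem : ∀ p ∈ s, p.Prime ∧ Y ≤ p ∧ p < 2 * Y := by
    intro p hp
    have h1 := Finset.mem_filter.1 (Finset.mem_filter.1 hp).1
    exact ⟨h1.2, hmem p h1.1⟩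
  have hbig : P / (2 * T) ≤ ‖∑ p ∈ s, (Real.log p : ℂ) * ∑ m ∈ Finset.Icc 1 (⌊P⌋₊ / Y) with
        m ∈ {m : ℕ | ∀ p ∈ m.primeFactors, (p : ℝ) ≤ R} ∧ p * m ≤ ⌊P⌋₊,
          e (α * ((p * m : ℕ) : ℝ) ^ 4)‖ := by
    linarith
  have hYP : (Y : ℝ) ^ 10 ≤ P := by
    have hne : s.Nonempty := by
      by_contra hne
      rw [Finset.not_nonempty_iff_eq_empty] at hne
      rw [hne, Finset.sum_empty, norm_zero] at hbig
      have : 0 < P / (2 * T) := by positivity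
      linarith
    obtain ⟨p, hp⟩ := hne
    have h1 : (Y : ℝ) ≤ P ^ ((1 : ℝ) / 10) :=
      (Nat.cast_le.2 (hsmem p hp).2.1).trans ((Finset.mem_filter.1 hp).2.trans hR)
    calc (Y : ℝ) ^ 10 ≤ (P ^ ((1 : ℝ) / 10)) ^ 10 := by gcongr
      _ = P := by
        rw [← Real.rpow_natCast, ← Real.rpow_mul hP0.le]
        norm_num
  obtain ⟨q, a, hq, hqC, ha⟩ := bilinear P T α Y s _ hT
    (by nlinarith) hYP hsmem hbig
  refine ⟨q, a, hq, hqC.trans ?_, ha.trans ?_⟩ <;> gcongr <;> linarith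

theorem norm_h_le {P : ℝ} (hP : 0 ≤ P) (R α : ℝ) : ‖h P R α‖ ≤ P := by
  refine (norm_sum_le _ _).trans ?_
  simp only [norm_e, Finset.sum_const, nsmul_eq_mul, mul_one]
  have h1 : (smoothA P R).card ≤ ⌊P⌋₊ := by
    refine (Finset.card_filter_le _ _).trans ?_
    rw [Nat.card_Icc, Nat.add_sub_cancel]
  exact (Nat.cast_le.2 h1).trans (Nat.floor_le hP)

theorem nonneg_and_le_of_near_unit_interval {x ε : ℝ} {q : ℕ} {u : ℤ} (hq : 1 ≤ q)
    (hx : x ∈ Set.Ico (0 : ℝ) 1) (hε : ε * q < 1) (hu : |x - u / q| ≤ ε) : 0 ≤ u ∧ u ≤ q := by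
  have hq0 : (0 : ℝ) < q := by exact_mod_cast hq
  have h1 : |x * q - u| < 1 := by
    have h2 : x * q - u = (x - u / q) * q := by field_simp
    rw [h2, abs_mul, abs_of_pos hq0]
    exact (mul_le_mul_of_nonneg_right hu hq0.le).trans_lt hε
  rw [abs_lt] at h1
  have h3 : 0 ≤ x * q := mul_nonneg hx.1 hq0.le
  have h4 : x * q < q := mul_lt_of_lt_one_left hq0 hx.2
  constructor
  · have : (-1 : ℝ) < u := by linarith
    have : (-1 : ℤ) < u := by exact_mod_cast this
    omega
  · have : (u : ℝ) < q + 1 := by linarith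
    have : u < (q : ℤ) + 1 := by exact_mod_cast this
    omega

theorem mem_majN_of_near_rational {P ε : ℝ} {x : ℝ × ℝ} {q : ℕ} {u v : ℤ}
    (hx₁ : x.1 ∈ Set.Ico (0 : ℝ) 1) (hx₂ : x.2 ∈ Set.Ico (0 : ℝ) 1) (hq : 1 ≤ q)
    (hqQ : (q : ℝ) ≤ Qbig P) (hε : ε * q < 1) (hεQ : ε ≤ Qbig P * P ^ (-(4 : ℤ)))
    (hu : |x.1 - u / q| ≤ ε) (hv : |x.2 - v / q| ≤ ε) : x ∈ majN P := by
  obtain ⟨hu0, huq⟩ := nonneg_and_le_of_near_unit_interval hq hx₁ hε hu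
  obtain ⟨hv0, hvq⟩ := nonneg_and_le_of_near_unit_interval hq hx₂ hε hv
  lift u to ℕ using hu0
  lift v to ℕ using hv0
  have huq' : u ≤ q := by exact_mod_cast huq
  have hvq' : v ≤ q := by exact_mod_cast hvq
  set g := Nat.gcd q (Nat.gcd u v) with hg
  have hg0 : 0 < g := Nat.gcd_pos_of_pos_left _ hq
  have hgq : g ∣ q := Nat.gcd_dvd_left _ _
  have hgu : g ∣ u := (Nat.gcd_dvd_right _ _).trans (Nat.gcd_dvd_left _ _)
  have hgv : g ∣ v := (Nat.gcd_dvd_right _ _).trans (Nat.gcd_dvd_right _ _)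
  have hgR : (g : ℝ) ≠ 0 := by exact_mod_cast hg0.ne'
  have hquot : ∀ w : ℕ, g ∣ w → ((w / g : ℕ) : ℝ) / ((q / g : ℕ) : ℝ) = (w : ℝ) / q := by
    intro w hw
    rw [Nat.cast_div hw hgR, Nat.cast_div hgq hgR, div_div_div_cancel_right₀ hgR]
  refine ⟨hx₁, hx₂, q / g, u / g, v / g, Nat.div_pos (Nat.le_of_dvd hq hgq) hg0, ?_,
    Nat.div_le_div_right huq', Nat.div_le_div_right hvq', ?_, ?_, ?_⟩
  · exact (Nat.cast_le.2 (Nat.div_le_self q g)).trans hqQ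
  · rw [Nat.gcd_div hgu hgv, Nat.gcd_div hgq (Nat.dvd_gcd hgu hgv), ← hg, Nat.div_self hg0]
  · rw [hquot u hgu]
    exact (by simpa using hu : |x.1 - (u : ℝ) / q| ≤ ε).trans hεQ
  · rw [hquot v hgv]
    exact (by simpa using hv : |x.2 - (v : ℝ) / q| ≤ ε).trans hεQ

theorem exists_rational_approx_of_linear_forms {ak bk al bl : ℤ} (hD : ak * bl - al * bk ≠ 0)
    {x y ε : ℝ} {q₁ q₂ : ℕ} {a₁ a₂ : ℤ} (hq₁ : 1 ≤ q₁) (hq₂ : 1 ≤ q₂)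
    (h₁ : |(ak : ℝ) * x + (bk : ℝ) * y - a₁ / q₁| ≤ ε)
    (h₂ : |(al : ℝ) * x + (bl : ℝ) * y - a₂ / q₂| ≤ ε) :
    ∃ (q : ℕ) (u v : ℤ), q = (ak * bl - al * bk).natAbs * (q₁ * q₂) ∧
      |x - u / q| ≤ (|(ak : ℝ)| + |(bk : ℝ)| + |(al : ℝ)| + |(bl : ℝ)|) * ε ∧
      |y - v / q| ≤ (|(ak : ℝ)| + |(bk : ℝ)| + |(al : ℝ)| + |(bl : ℝ)|) * ε := by
  set D := ak * bl - al * bk with hDdef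
  have hε : 0 ≤ ε := (abs_nonneg _).trans h₁
  have hq₁R : (q₁ : ℝ) ≠ 0 := by
    have : q₁ ≠ 0 := by omega
    exact_mod_cast this
  have hq₂R : (q₂ : ℝ) ≠ 0 := by
    have : q₂ ≠ 0 := by omega
    exact_mod_cast this
  have hDR : (D : ℝ) ≠ 0 := by exact_mod_cast hD
  have hDD : (D : ℝ) = ak * bl - al * bk := by
    rw [hDdef]
    push_cast
    ring
  have habs : ((D.natAbs : ℕ) : ℝ) = |(D : ℝ)| := by
    rw [Nat.cast_natAbs, Int.cast_abs]
  have hDabs : 1 ≤ |(D : ℝ)| := by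
    rw [← habs]
    exact_mod_cast Int.natAbs_pos.2 hD
  have hsign : (D.sign : ℝ) * |(D : ℝ)| = D := by
    rw [← Int.cast_abs]
    exact_mod_cast Int.sign_mul_abs D
  have hsign' : (D.sign : ℝ) / |(D : ℝ)| = 1 / D := by
    have h3 : |(D : ℝ)| * |(D : ℝ)| = D * D := abs_mul_abs_self _
    rw [div_eq_div_iff (by positivity) hDR, one_mul]
    have h4 : ((D.sign : ℝ) * D) * |(D : ℝ)| = |(D : ℝ)| * |(D : ℝ)| := by
      rw [h3, mul_right_comm, hsign]
    exact mul_right_cancel₀ (by positivity) h4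
  have hfrac : ∀ w : ℤ, ((D.sign * w : ℤ) : ℝ) / ((D.natAbs * (q₁ * q₂) : ℕ) : ℝ) =
      w / (D * (q₁ * q₂)) := by
    intro w
    push_cast
    rw [habs, mul_div_mul_comm, hsign', div_mul_div_comm, one_mul]
  have key : ∀ (z c d : ℝ), |c| + |d| ≤ |(ak : ℝ)| + |(bk : ℝ)| + |(al : ℝ)| + |(bl : ℝ)| →
      z = (c * ((ak : ℝ) * x + (bk : ℝ) * y - a₁ / q₁) +
        d * ((al : ℝ) * x + (bl : ℝ) * y - a₂ / q₂)) / D →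
      |z| ≤ (|(ak : ℝ)| + |(bk : ℝ)| + |(al : ℝ)| + |(bl : ℝ)|) * ε := by
    intro z c d hcd hz
    rw [hz, abs_div]
    refine (div_le_self (abs_nonneg _) hDabs).trans ((abs_add_le _ _).trans ?_)
    rw [abs_mul, abs_mul]
    calc _ ≤ |c| * ε + |d| * ε := by gcongr
      _ = (|c| + |d|) * ε := by ring
      _ ≤ _ := by gcongr
  have p1 := abs_nonneg (ak : ℝ)
  have p2 := abs_nonneg (bk : ℝ)
  have p3 := abs_nonneg (al : ℝ)
  have p4 := abs_nonneg (bl : ℝ)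
  refine ⟨_, D.sign * (bl * a₁ * q₂ - bk * a₂ * q₁), D.sign * (ak * a₂ * q₁ - al * a₁ * q₂), rfl,
    ?_, ?_⟩
  · refine key _ bl (-bk) (by rw [abs_neg]; linarith) ?_
    rw [hfrac]
    push_cast
    field_simp
    rw [hDD]
    ring
  · refine key _ (-al) ak (by rw [abs_neg]; linarith) ?_
    rw [hfrac]
    push_cast
    field_simp
    rw [hDD]
    ring

theorem exists_forall_mul_pow_le_two_rpow {C : ℝ} (hC : 0 < C) (k : ℕ) :
    ∃ T₀ : ℝ, ∀ T : ℝ, T₀ ≤ T → C * T ^ k ≤ (2 : ℝ) ^ T := by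
  have h1 := (isLittleO_pow_exp_pos_mul_atTop k (Real.log_pos one_lt_two)).def
    (show 0 < C⁻¹ by positivity)
  obtain ⟨T₀, hT₀⟩ := eventually_atTop.1 h1
  refine ⟨T₀, fun T hT => ?_⟩
  have h2 := hT₀ T hT
  rw [Real.norm_eq_abs, Real.norm_eq_abs, Real.abs_exp, le_inv_mul_iff₀ hC] at h2
  rw [Real.rpow_def_of_pos two_pos]
  exact (mul_le_mul_of_nonneg_left (le_abs_self _) hC.le).trans h2

/-- for some `η > 0`, if `Λ_k = a_kα + b_kβ` and `Λ_l = a_lα + b_lβ` are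
nonzero, linearly independent binary forms, then for all large `P` and `2 ≤ R ≤ P^η` one has
`sup_{(α,β)∈𝔫} |h(Λ_k)h(Λ_l)| ≪ P²·Q^{−1/100}`. -/
theorem minor_arc_sup_bound :
    ∃ η : ℝ, 0 < η ∧
      ∀ ak bk al bl : ℤ, ¬(ak = 0 ∧ bk = 0) → ¬(al = 0 ∧ bl = 0) →
        ak * bl - al * bk ≠ 0 →
        ∃ C P₀ : ℝ, ∀ P R : ℝ, P₀ ≤ P → 2 ≤ R → R ≤ P ^ η →
          ∀ x ∈ minorn P,
            ‖h P R ((ak : ℝ) * x.1 + (bk : ℝ) * x.2) *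
                h P R ((al : ℝ) * x.1 + (bl : ℝ) * x.2)‖
              ≤ C * P ^ 2 * Qbig P ^ (-(1:ℝ)/100) := by
  obtain ⟨C₀, hC₀, approx⟩ := exists_rational_approx_of_large_smooth_sum
  obtain ⟨T₀, hT₀⟩ := exists_forall_mul_pow_le_two_rpow (show 0 < C₀ by linarith) 200
  refine ⟨1 / 10, by norm_num, fun ak bk al bl _ _ hD => ?_⟩
  set S : ℝ := |(ak : ℝ)| + |(bk : ℝ)| + |(al : ℝ)| + |(bl : ℝ)| with hS
  set D := ak * bl - al * bk with hDdef
  have hS0 : 0 ≤ S := by positivity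
  set T₁ : ℝ := 1 + |T₀| + S * C₀ + D.natAbs * C₀ ^ 2 with hT₁
  have hT₁1 : 1 ≤ T₁ := by
    have : 0 ≤ S * C₀ := by positivity
    have : 0 ≤ D.natAbs * C₀ ^ 2 := by positivity
    have := abs_nonneg T₀
    linarith
  obtain ⟨n, hn⟩ : ∃ n : ℕ, n = 10000 := ⟨_, rfl⟩
  have hn200 : 200 ≤ n := by omega
  have hnR : (n : ℝ) = 10000 := by
    rw [hn]
    norm_num
  clear hn
  refine ⟨26, Real.exp (T₁ ^ n), fun P R hP hR hRP x hx => ?_⟩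
  have hP0 : 0 < P := (Real.exp_pos _).trans_le hP
  set L := Real.log P with hL
  have hLT₁ : T₁ ^ n ≤ L := (Real.le_log_iff_exp_le hP0).2 hP
  have hL1 : 1 ≤ L := (one_le_pow₀ hT₁1).trans hLT₁
  have hL0 : 0 < L := by linarith
  set T : ℝ := L ^ ((1 : ℝ) / 10000) with hT
  have hTL : T ^ n = L := by
    rw [hT, ← Real.rpow_natCast, ← Real.rpow_mul hL0.le, hnR]
    norm_num
  have hT0 : 0 < T := Real.rpow_pos_of_pos hL0 _
  have hTT₁ : T₁ ≤ T := by
    refine le_of_pow_le_pow_left₀ (n := n) (by omega) hT0.le ?_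
    rw [hTL]
    exact hLT₁
  have hT1 : 1 ≤ T := hT₁1.trans hTT₁
  have hQ : Qbig P = T ^ 100 := by
    rw [Qbig, hT, ← Real.rpow_natCast, ← Real.rpow_mul hL0.le]
    norm_num [hL]
  have hQT : Qbig P ^ (-(1 : ℝ) / 100) = 1 / T := by
    rw [hQ, ← Real.rpow_natCast, ← Real.rpow_mul hT0.le]
    norm_num
    exact Real.rpow_neg_one T
  have hLP : L < P := by
    have := Real.log_le_sub_one_of_pos hP0
    linarith
  have hP1 : 1 ≤ P := hL1.trans hLP.le
  have hTLT : T ≤ L / T := by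
    rw [le_div_iff₀ hT0, ← hTL, ← sq]
    exact pow_le_pow_right₀ hT1 (by omega)
  have p1 : 0 ≤ S * C₀ := by positivity
  have p2 : 0 ≤ D.natAbs * C₀ ^ 2 := by positivity
  have p3 := abs_nonneg T₀
  have h2T : C₀ * T ^ 200 ≤ (2 : ℝ) ^ T := hT₀ T (by linarith [le_abs_self T₀])
  by_contra! hcon
  rw [hQT, norm_mul] at hcon
  have hlarge : ∀ u v : ℝ, u ≤ P → 0 ≤ v → v ≤ P → 26 * P ^ 2 * (1 / T) < u * v →
      26 * P / T ≤ u := by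
    intro u v _ hv0 hvP huv
    by_contra! hu
    have h1 : u * v ≤ 26 * P / T * P :=
      mul_le_mul hu.le hvP hv0 (by positivity)
    have h2 : 26 * P / T * P = 26 * P ^ 2 * (1 / T) := by ring
    linarith
  have hk := hlarge _ _ (norm_h_le hP0.le _ _) (norm_nonneg _) (norm_h_le hP0.le _ _) hcon
  rw [mul_comm ‖_‖ ‖_‖] at hcon
  have hl := hlarge _ _ (norm_h_le hP0.le _ _) (norm_nonneg _) (norm_h_le hP0.le _ _) hcon
  obtain ⟨q₁, a₁, hq₁, hq₁C, ha₁⟩ := approx P R T _ hP1 hRP hT1 hTLT h2T hk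
  obtain ⟨q₂, a₂, hq₂, hq₂C, ha₂⟩ := approx P R T _ hP1 hRP hT1 hTLT h2T hl
  obtain ⟨q, u, v, hq, hu, hv⟩ := exists_rational_approx_of_linear_forms hD hq₁ hq₂ ha₁ ha₂
  have hq1 : 1 ≤ q := by
    rw [hq]
    exact Nat.mul_pos (Int.natAbs_pos.2 hD) (Nat.mul_pos hq₁ hq₂)
  have hqQ : (q : ℝ) ≤ T ^ 100 := by
    rw [hq]
    push_cast
    calc (D.natAbs : ℝ) * (q₁ * q₂) ≤ D.natAbs * ((C₀ * T ^ 40) * (C₀ * T ^ 40)) := by gcongr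
      _ = (D.natAbs * C₀ ^ 2) * T ^ 80 := by ring
      _ ≤ T * T ^ 80 := by
        gcongr
        linarith
      _ = T ^ 81 := by ring
      _ ≤ T ^ 100 := pow_le_pow_right₀ hT1 (by norm_num)
  have hεQ : S * (C₀ * T ^ 86 / P ^ 4) ≤ T ^ 100 / P ^ 4 := by
    rw [← mul_div_assoc]
    gcongr
    calc S * (C₀ * T ^ 86) = (S * C₀) * T ^ 86 := by ring
      _ ≤ T * T ^ 86 := by
        gcongr
        linarith
      _ = T ^ 87 := by ring
      _ ≤ T ^ 100 := pow_le_pow_right₀ hT1 (by norm_num)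
  have hεq : S * (C₀ * T ^ 86 / P ^ 4) * q < 1 := by
    calc S * (C₀ * T ^ 86 / P ^ 4) * q ≤ T ^ 100 / P ^ 4 * T ^ 100 := by gcongr
      _ = T ^ 200 / P ^ 4 := by ring
      _ < 1 := by
        rw [div_lt_one (by positivity)]
        calc T ^ 200 ≤ T ^ n := pow_le_pow_right₀ hT1 hn200
          _ = L := hTL
          _ < P := hLP
          _ ≤ P ^ 4 := le_self_pow₀ hP1 (by norm_num)
  refine hx.2 (mem_majN_of_near_rational hx.1.1 hx.1.2 hq1 (hQ ▸ hqQ) hεq ?_ hu hv)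
  rw [hQ, zpow_neg, ← div_eq_mul_inv]
  exact_mod_cast hεQ
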